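/- Let p ∈ [2,∞). Define 𝒯 as the smallest constant (possibly ∞) such that Λ_Q(φ_Q, g) ≤ 𝒯 ‖φ_Q‖_{L^p(σ;ℓ²)} ‖g‖_{L^{p'}(ω)} for every Q ∈ 𝒟 and every nonnegative Borel function g, and 𝒯* as the smallest constant such that Λ_Q(f, 1_Q) ≤ 𝒯* ‖f‖_{L^p(σ;ℓ²)} ω(Q)^{1/p'} for every Q ∈ 𝒟 and every nonnegative σ×η-measurable f. Then there exists a finite constant C such that Λ(f,g) ≤ C ‖f‖_{L^p(σ;ℓ²)} ‖g‖_{L^{p'}(ω)} for all nonnegative σ×η-measurable f and nonnegative Borel g if and only if 𝒯 + 𝒯* < ∞; moreover, the smallest such constant ‖Λ‖ satisfies c_p (𝒯 + 𝒯*) ≤ ‖Λ‖ ≤ C_p (𝒯 + 𝒯*) for constants c_p, C_p > 0 depending only on p. -/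

import Mathlib

open MeasureTheory ENNReal Set
open scoped Classical NNReal ENNReal

noncomputable section

/-- The index of a dyadic cube `2^{-k}([0,1)^n + m)` of the standard dyadic lattice `𝒟`. -/
abbrev CubeIdx (n : ℕ) := ℤ × (Fin n → ℤ)

/-- The dyadic cube `2^{-k}([0,1)^n + m)`. -/
def dyadicCube (n : ℕ) (k : ℤ) (m : Fin n → ℤ) : Set (Fin n → ℝ) :=
  {x | ∀ i, x i ∈ Set.Ico ((2:ℝ) ^ (-k) * (m i : ℝ)) ((2:ℝ) ^ (-k) * ((m i : ℝ) + 1))}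

/-- The dyadic cube associated to an index. -/
def idxCube (n : ℕ) (Q : CubeIdx n) : Set (Fin n → ℝ) := dyadicCube n Q.1 Q.2

/-- The Carleson box `Q̂ = Q × (0, ℓ(Q)]`, where `ℓ(Q) = 2^{-k}`. -/
def carlesonBox (n : ℕ) (k : ℤ) (m : Fin n → ℤ) : Set ((Fin n → ℝ) × ℝ) :=
  (dyadicCube n k m) ×ˢ (Set.Ioc (0:ℝ) ((2:ℝ) ^ (-k)))

/-- The vertical `ℓ²`-norm `|f|_{ℓ²}(x) = (∑_{k ∈ ℤ} f(x, 2^{-k})²)^{1/2}`. -/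
def vertL2 (n : ℕ) (f : (Fin n → ℝ) × ℝ → ℝ≥0∞) (x : Fin n → ℝ) : ℝ≥0∞ :=
  (∑' k : ℤ, (f (x, (2:ℝ) ^ (-k))) ^ 2) ^ (1/2 : ℝ)

/-- The mixed norm `‖f‖_{L^q(σ; ℓ²)} = (∫ |f|_{ℓ²}^q dσ)^{1/q}`. -/
def mixedNorm (n : ℕ) (σ : Measure (Fin n → ℝ)) (q : ℝ)
    (f : (Fin n → ℝ) × ℝ → ℝ≥0∞) : ℝ≥0∞ :=
  (∫⁻ x, (vertL2 n f x) ^ q ∂σ) ^ (1/q)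

/-- The norm `‖g‖_{L^q(ω)} = (∫ g^q dω)^{1/q}` of a nonnegative function. -/
def lpNorm (n : ℕ) (ω : Measure (Fin n → ℝ)) (q : ℝ) (g : (Fin n → ℝ) → ℝ≥0∞) : ℝ≥0∞ :=
  (∫⁻ x, (g x) ^ q ∂ω) ^ (1/q)

/-- `∬_{Q̂} f μ dη dσ = ∑_{j ∈ ℤ, 2^j ≤ ℓ(Q)} ∫_Q f(x, 2^j) μ(x, 2^j) dσ(x)`. -/
def boxInt (n : ℕ) (σ : Measure (Fin n → ℝ)) (μ : (Fin n → ℝ) × ℝ → ℝ≥0∞)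
    (f : (Fin n → ℝ) × ℝ → ℝ≥0∞) (k : ℤ) (m : Fin n → ℤ) : ℝ≥0∞ :=
  ∑' j : ℤ, if (2:ℝ) ^ j ≤ (2:ℝ) ^ (-k) then
      ∫⁻ x in dyadicCube n k m, f (x, (2:ℝ) ^ j) * μ (x, (2:ℝ) ^ j) ∂σ
    else 0

/-- `1_{Q̂} μ`. -/
def boxFn (n : ℕ) (μ : (Fin n → ℝ) × ℝ → ℝ≥0∞) (k : ℤ) (m : Fin n → ℤ) :
    (Fin n → ℝ) × ℝ → ℝ≥0∞ :=
  (carlesonBox n k m).indicator μ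

/-- The test function `φ_Q = |1_{Q̂} μ|_{ℓ²}^{p'-2} 1_{Q̂} μ`,
interpreted as `0` where `|1_{Q̂} μ|_{ℓ²} = 0`. -/
def testFn (n : ℕ) (p' : ℝ) (μ : (Fin n → ℝ) × ℝ → ℝ≥0∞) (k : ℤ) (m : Fin n → ℤ) :
    (Fin n → ℝ) × ℝ → ℝ≥0∞ :=
  fun z => if vertL2 n (boxFn n μ k m) z.1 = 0 then 0
    else (vertL2 n (boxFn n μ k m) z.1) ^ (p' - 2) * boxFn n μ k m z

/-- The bilinear form `Λ(f,g) = ∑_{Q ∈ 𝒟} λ_Q (∬_{Q̂} f μ dη dσ) (∫_Q g dω)`. -/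
def lambdaForm (n : ℕ) (σ ω : Measure (Fin n → ℝ)) (μ : (Fin n → ℝ) × ℝ → ℝ≥0∞)
    (lam : CubeIdx n → ℝ≥0) (f : (Fin n → ℝ) × ℝ → ℝ≥0∞) (g : (Fin n → ℝ) → ℝ≥0∞) :
    ℝ≥0∞ :=
  ∑' Q : CubeIdx n,
    (lam Q : ℝ≥0∞) * boxInt n σ μ f Q.1 Q.2 * ∫⁻ x in idxCube n Q, g x ∂ω

/-- The localized bilinear form `Λ_{Q₀}(f,g)`, where the sum is restricted to
dyadic cubes `Q ⊆ Q₀`. -/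
def lambdaLoc (n : ℕ) (σ ω : Measure (Fin n → ℝ)) (μ : (Fin n → ℝ) × ℝ → ℝ≥0∞)
    (lam : CubeIdx n → ℝ≥0) (Q₀ : CubeIdx n)
    (f : (Fin n → ℝ) × ℝ → ℝ≥0∞) (g : (Fin n → ℝ) → ℝ≥0∞) : ℝ≥0∞ :=
  ∑' Q : CubeIdx n, if idxCube n Q ⊆ idxCube n Q₀ then
      (lam Q : ℝ≥0∞) * boxInt n σ μ f Q.1 Q.2 * ∫⁻ x in idxCube n Q, g x ∂ω
    else 0

/-- The average `⟨h⟩_Q^ν = ν(Q)⁻¹ ∫_Q h dν`, understood as `0` when `ν(Q) = 0`. -/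
def cubeAvg (n : ℕ) (ν : Measure (Fin n → ℝ)) (h : (Fin n → ℝ) → ℝ≥0∞)
    (k : ℤ) (m : Fin n → ℤ) : ℝ≥0∞ :=
  (∫⁻ x in dyadicCube n k m, h x ∂ν) / ν (dyadicCube n k m)


/-- The testing constant `𝒯`: the smallest constant (possibly `∞`) in the testing
inequality `Λ_Q(φ_Q, g) ≤ 𝒯 ‖φ_Q‖_{L^p(σ;ℓ²)} ‖g‖_{L^{p'}(ω)}`. -/
def testConstT (n : ℕ) (σ ω : Measure (Fin n → ℝ)) (μ : (Fin n → ℝ) × ℝ → ℝ≥0∞)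
    (lam : CubeIdx n → ℝ≥0) (p : ℝ) : ℝ≥0∞ :=
  sInf {t : ℝ≥0∞ | ∀ (Q : CubeIdx n) (g : (Fin n → ℝ) → ℝ≥0∞), Measurable g →
    lambdaLoc n σ ω μ lam Q (testFn n (p/(p-1)) μ Q.1 Q.2) g
      ≤ t * mixedNorm n σ p (testFn n (p/(p-1)) μ Q.1 Q.2) * lpNorm n ω (p/(p-1)) g}

/-- The dual testing constant `𝒯*`: the smallest constant (possibly `∞`) in the testing
inequality `Λ_Q(f, 1_Q) ≤ 𝒯* ‖f‖_{L^p(σ;ℓ²)} ω(Q)^{1/p'}`. -/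
def testConstTStar (n : ℕ) (σ ω : Measure (Fin n → ℝ)) (μ : (Fin n → ℝ) × ℝ → ℝ≥0∞)
    (lam : CubeIdx n → ℝ≥0) (p : ℝ) : ℝ≥0∞ :=
  sInf {t : ℝ≥0∞ | ∀ (Q : CubeIdx n) (f : (Fin n → ℝ) × ℝ → ℝ≥0∞), Measurable f →
    lambdaLoc n σ ω μ lam Q f ((idxCube n Q).indicator 1)
      ≤ t * mixedNorm n σ p f * (ω (idxCube n Q)) ^ (1/(p/(p-1)))}

/-- The norm `‖Λ‖`: the smallest constant (possibly `∞`) in the inequality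
`Λ(f,g) ≤ C ‖f‖_{L^p(σ;ℓ²)} ‖g‖_{L^{p'}(ω)}`. -/
def lambdaNorm (n : ℕ) (σ ω : Measure (Fin n → ℝ)) (μ : (Fin n → ℝ) × ℝ → ℝ≥0∞)
    (lam : CubeIdx n → ℝ≥0) (p : ℝ) : ℝ≥0∞ :=
  sInf {t : ℝ≥0∞ | ∀ (f : (Fin n → ℝ) × ℝ → ℝ≥0∞) (g : (Fin n → ℝ) → ℝ≥0∞),
    Measurable f → Measurable g →
    lambdaForm n σ ω μ lam f g ≤ t * mixedNorm n σ p f * lpNorm n ω (p/(p-1)) g}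

section Stopping

variable {ι : Type*} [PartialOrder ι]

/-- `F` is the smallest member of `𝓕` containing `Q`. -/
def IsStopTop (𝓕 : Finset ι) (F Q : ι) : Prop :=
  F ∈ 𝓕 ∧ Q ≤ F ∧ ∀ R ∈ 𝓕, Q ≤ R → F ≤ R

/-- `P` is the smallest member of `𝓕` strictly containing `F`. -/
def IsStopPar (𝓕 : Finset ι) (P F : ι) : Prop :=
  P ∈ 𝓕 ∧ F < P ∧ ∀ R ∈ 𝓕, F < R → P ≤ R

/-- The members of `𝓕` whose parent is `F`. -/
def stopChildren (𝓕 : Finset ι) (F : ι) : Finset ι := 𝓕.filter (IsStopPar 𝓕 F)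

theorem IsStopTop.unique {𝓕 : Finset ι} {F G Q : ι} (hF : IsStopTop 𝓕 F Q) (hG : IsStopTop 𝓕 G Q) :
    F = G :=
  le_antisymm (hF.2.2 _ hG.1 hG.2.1) (hG.2.2 _ hF.1 hF.2.1)

theorem IsStopPar.unique {𝓕 : Finset ι} {F G Q : ι} (hF : IsStopPar 𝓕 F Q) (hG : IsStopPar 𝓕 G Q) :
    F = G :=
  le_antisymm (hF.2.2 _ hG.1 hG.2.1) (hG.2.2 _ hF.1 hF.2.1)

/-- Any two elements with a common lower bound are comparable. -/
def IsForest (ι : Type*) [PartialOrder ι] : Prop :=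
  ∀ Q R S : ι, Q ≤ R → Q ≤ S → R ≤ S ∨ S ≤ R

theorem IsForest.exists_isStopTop (hι : IsForest ι) (𝓕 : Finset ι) {Q : ι}
    (h : ∃ R ∈ 𝓕, Q ≤ R) : ∃ F, IsStopTop 𝓕 F Q := by
  obtain ⟨R, hR, hQR⟩ := h
  have hne : (𝓕.filter (fun R => Q ≤ R)).Nonempty := ⟨R, by simp [hR, hQR]⟩
  obtain ⟨F, hF⟩ := Finset.exists_minimal hne
  have hF1 := hF.1
  simp only [Finset.mem_filter] at hF1
  refine ⟨F, hF1.1, hF1.2, fun R hR hQR => ?_⟩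
  rcases hι Q F R hF1.2 hQR with h | h
  · exact h
  · exact hF.2 (by simp [hR, hQR]) h

/-- Construction of stopping elements in a finite forest. -/
theorem IsForest.exists_stopping (hι : IsForest ι) (a : ι → ℝ≥0∞) (ha : ∀ Q, a Q ≠ ∞)
    (ok : ι → ℝ≥0∞ → ι → Prop) (hok : ∀ Q v, a Q ≤ v → ok Q v Q) (𝓐 : Finset ι) :
    ∃ (𝓕 : Finset ι) (A : ι → ℝ≥0∞), 𝓕 ⊆ 𝓐 ∧
      (∀ Q ∈ 𝓐, ∃ F, IsStopTop 𝓕 F Q ∧ ok F (A F) Q) ∧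
      (∀ F ∈ 𝓕, a F ≤ A F) ∧
      (∀ F ∈ 𝓕, A F ≠ ∞) ∧
      (∀ F ∈ 𝓕, A F = a F ∨ ∃ P, IsStopPar 𝓕 P F ∧ A F = 2 * A P) ∧
      (∀ F ∈ 𝓕, ∀ P, IsStopPar 𝓕 P F → ¬ ok P (A P) F) ∧
      (∀ F ∈ 𝓕, ∀ R ∈ 𝓕, F < R → 2 * A R ≤ A F) := by
  induction h𝓐 : 𝓐.card generalizing 𝓐 with
  | zero =>
    rw [Finset.card_eq_zero] at h𝓐
    subst h𝓐
    exact ⟨∅, 0, by simp⟩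
  | succ N ih =>
    have hne : 𝓐.Nonempty := by rw [← Finset.card_pos]; omega
    obtain ⟨Q₀, hQ₀, hmin⟩ := Finset.exists_minimal hne
    obtain ⟨𝓕, A, hsub, htop, hle, hfin, heq, hnok, hdbl⟩ := ih (𝓐.erase Q₀) (by
      rw [Finset.card_erase_of_mem hQ₀]; omega)
    have hmem : ∀ F ∈ 𝓕, F ∈ 𝓐 ∧ F ≠ Q₀ := fun F hF => by
      have := hsub hF
      simp only [Finset.mem_erase] at this
      exact ⟨this.2, this.1⟩
    have hnle : ∀ Q ∈ 𝓐, Q ≤ Q₀ → Q = Q₀ := fun Q hQ h => le_antisymm h (hmin hQ h)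
    have hQ₀𝓕 : Q₀ ∉ 𝓕 := fun h => (hmem _ h).2 rfl
    by_cases hkeep : ∃ F, IsStopTop 𝓕 F Q₀ ∧ ok F (A F) Q₀
    · refine ⟨𝓕, A, fun F hF => (hmem F hF).1, fun Q hQ => ?_, hle, hfin, heq, hnok, hdbl⟩
      by_cases h : Q = Q₀
      · rw [h]; exact hkeep
      · exact htop Q (by simp [h, hQ])
    -- the value at the new stopping element
    obtain ⟨v, hav, hv, hv', hvd⟩ : ∃ v : ℝ≥0∞, a Q₀ ≤ v ∧ v ≠ ∞ ∧
        (v = a Q₀ ∨ ∃ P, IsStopTop 𝓕 P Q₀ ∧ v = 2 * A P) ∧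
        (∀ P, IsStopTop 𝓕 P Q₀ → 2 * A P ≤ v) := by
      by_cases h : ∃ F, IsStopTop 𝓕 F Q₀
      · obtain ⟨F, hF⟩ := h
        refine ⟨max (a Q₀) (2 * A F), le_max_left _ _, ?_, ?_, fun P hP => ?_⟩
        · exact (max_lt (ha _).lt_top
            (ENNReal.mul_lt_top (by simp) (hfin F hF.1).lt_top)).ne
        · rcases max_choice (a Q₀) (2 * A F) with h | h
          · exact Or.inl h
          · exact Or.inr ⟨F, hF, h⟩
        · rw [hP.unique hF]; exact le_max_right _ _
      · exact ⟨a Q₀, le_rfl, ha _, Or.inl rfl, fun P hP => (h ⟨P, hP⟩).elim⟩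
    have hA : ∀ F ∈ 𝓕, Function.update A Q₀ v F = A F := fun F hF => by
      rw [Function.update_of_ne (hmem F hF).2]
    have hparnew : ∀ P, IsStopTop 𝓕 P Q₀ ↔ IsStopPar (insert Q₀ 𝓕) P Q₀ := fun P => by
      constructor
      · rintro ⟨h1, h2, h3⟩
        refine ⟨by simp [h1], lt_of_le_of_ne h2 (hmem P h1).2.symm, fun R hR hlt => ?_⟩
        rcases Finset.mem_insert.1 hR with rfl | hR
        · exact (lt_irrefl _ hlt).elim
        · exact h3 R hR hlt.le
      · rintro ⟨h1, h2, h3⟩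
        rcases Finset.mem_insert.1 h1 with rfl | h1
        · exact (lt_irrefl _ h2).elim
        · refine ⟨h1, h2.le, fun R hR hle => h3 R (by simp [hR]) ?_⟩
          exact lt_of_le_of_ne hle (hmem R hR).2.symm
    have hparold : ∀ F ∈ 𝓕, ∀ P, IsStopPar (insert Q₀ 𝓕) P F ↔ IsStopPar 𝓕 P F := fun F hF P => by
      have hno : ¬ F < Q₀ := fun h => (hmem F hF).2 (hnle F (hmem F hF).1 h.le)
      constructor
      · rintro ⟨h1, h2, h3⟩
        rcases Finset.mem_insert.1 h1 with rfl | h1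
        · exact (hno h2).elim
        · exact ⟨h1, h2, fun R hR => h3 R (by simp [hR])⟩
      · rintro ⟨h1, h2, h3⟩
        refine ⟨by simp [h1], h2, fun R hR hlt => ?_⟩
        rcases Finset.mem_insert.1 hR with rfl | hR
        · exact (hno hlt).elim
        · exact h3 R hR hlt
    refine ⟨insert Q₀ 𝓕, Function.update A Q₀ v, ?_, ?_, ?_, ?_, ?_, ?_, ?_⟩
    · exact Finset.insert_subset hQ₀ fun F hF => (hmem F hF).1
    · intro Q hQ
      by_cases h : Q = Q₀
      · subst h
        refine ⟨Q, ⟨by simp, le_rfl, fun R _ h => h⟩, ?_⟩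
        rw [Function.update_self]
        exact hok _ _ hav
      · obtain ⟨F, ⟨h1, h2, h3⟩, h4⟩ := htop Q (by simp [h, hQ])
        refine ⟨F, ⟨by simp [h1], h2, fun R hR hle => ?_⟩, by rwa [hA F h1]⟩
        rcases Finset.mem_insert.1 hR with rfl | hR
        · exact (h (hnle Q hQ hle)).elim
        · exact h3 R hR hle
    · intro F hF
      rcases Finset.mem_insert.1 hF with rfl | hF
      · simpa using hav
      · rw [hA F hF]; exact hle F hF
    · intro F hF
      rcases Finset.mem_insert.1 hF with rfl | hF
      · simpa using hv
      · rw [hA F hF]; exact hfin F hF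
    · intro F hF
      rcases Finset.mem_insert.1 hF with rfl | hF
      · rw [Function.update_self]
        refine hv'.imp id ?_
        rintro ⟨P, hP, h⟩
        exact ⟨P, (hparnew P).1 hP, by rw [hA P hP.1, h]⟩
      · rw [hA F hF]
        refine (heq F hF).imp id ?_
        rintro ⟨P, hP, h⟩
        exact ⟨P, (hparold F hF P).2 hP, by rw [hA P hP.1, h]⟩
    · intro F hF P hP
      rcases Finset.mem_insert.1 hF with rfl | hF
      · have hP' := (hparnew P).2 hP
        rw [hA P hP'.1]
        exact fun h => hkeep ⟨P, hP', h⟩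
      · have hP' := (hparold F hF P).1 hP
        rw [hA P hP'.1]
        exact hnok F hF P hP'
    · intro F hF R hR hlt
      rcases Finset.mem_insert.1 hR with rfl | hR'
      · rcases Finset.mem_insert.1 hF with rfl | hF
        · exact (lt_irrefl _ hlt).elim
        · exact ((hmem F hF).2 (hnle F (hmem F hF).1 hlt.le)).elim
      rw [hA R hR']
      rcases Finset.mem_insert.1 hF with rfl | hF
      · rw [Function.update_self]
        obtain ⟨P, hP⟩ := hι.exists_isStopTop 𝓕 ⟨R, hR', hlt.le⟩
        refine le_trans ?_ (hvd P hP)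
        rcases (hP.2.2 R hR' hlt.le).eq_or_lt with rfl | h
        · exact le_rfl
        · calc 2 * A R ≤ A P := hdbl P hP.1 R hR' h
            _ ≤ 2 * A P := le_mul_of_one_le_left (by simp) (by norm_num)
      · rw [hA F hF]; exact hdbl F hF R hR' hlt

theorem mem_stopChildren {𝓕 : Finset ι} {F G : ι} :
    G ∈ stopChildren 𝓕 F ↔ G ∈ 𝓕 ∧ IsStopPar 𝓕 F G := by
  simp [stopChildren]

/-- Two comparable children of the same element agree. -/
theorem eq_of_mem_stopChildren {𝓕 : Finset ι} {F G H : ι} (hG : G ∈ stopChildren 𝓕 F)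
    (hH : H ∈ stopChildren 𝓕 F) (h : G ≤ H ∨ H ≤ G) : G = H := by
  rw [mem_stopChildren] at hG hH
  wlog hGH : G ≤ H generalizing G H
  · exact (this hH hG h.symm (h.resolve_left hGH)).symm
  by_contra hne
  exact (hG.2.2.2 H hH.1 (lt_of_le_of_ne hGH hne)).not_gt hH.2.2.1

theorem IsForest.sum_stopChildren_le {𝓕 : Finset ι} (y : ι → ℝ≥0∞) :
    ∑ F ∈ 𝓕, ∑ G ∈ stopChildren 𝓕 F, y G ≤ ∑ G ∈ 𝓕, y G := by
  simp only [stopChildren, Finset.sum_filter]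
  rw [Finset.sum_comm]
  refine Finset.sum_le_sum fun G hG => ?_
  by_cases h : ∃ P, IsStopPar 𝓕 P G
  · obtain ⟨P, hP⟩ := h
    rw [Finset.sum_eq_single_of_mem P hP.1]
    · split_ifs; simp
    · intro R _ hR
      rw [if_neg]
      exact fun h => hR (h.unique hP)
  · push Not at h
    simp [h]

/-- An element strictly inside `F` is inside a child of `F`. -/
theorem IsForest.exists_stopChild (hι : IsForest ι) {𝓕 : Finset ι} {F G : ι} (hF : F ∈ 𝓕)
    (hG : G ∈ 𝓕) (h : G < F) : ∃ H ∈ stopChildren 𝓕 F, G ≤ H := by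
  have hne : (𝓕.filter (fun R => G ≤ R ∧ R < F)).Nonempty := ⟨G, by simp [hG, h]⟩
  obtain ⟨H, hH⟩ := Finset.exists_maximal hne
  have hH1 := hH.1
  simp only [Finset.mem_filter] at hH1
  refine ⟨H, mem_stopChildren.2 ⟨hH1.1, hF, hH1.2.2, fun R hR hlt => ?_⟩, hH1.2.1⟩
  rcases hι H F R hH1.2.2.le hlt.le with h' | h'
  · exact h'
  · rcases h'.eq_or_lt with rfl | h'
    · exact le_rfl
    · exact (hlt.not_ge (hH.2 (by simp [hR, h', hH1.2.1.trans hlt.le]) hlt.le)).elim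

end Stopping

section Sums

variable {ι : Type*}

/-- The sum of the geometric series with ratio `2^{-s}`. -/
def geomConst (s : ℝ) : ℝ≥0∞ := (1 - (2 : ℝ≥0∞) ^ (-s))⁻¹

theorem two_rpow_neg_lt_one {s : ℝ} (hs : 0 < s) : (2 : ℝ≥0∞) ^ (-s) < 1 := by
  rw [ENNReal.rpow_neg, ENNReal.inv_lt_one]
  exact ENNReal.one_lt_rpow (by norm_num) hs

theorem geomConst_ne_top {s : ℝ} (hs : 0 < s) : geomConst s ≠ ∞ := by
  rw [geomConst, Ne, ENNReal.inv_eq_top, tsub_eq_zero_iff_le, not_le]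
  exact two_rpow_neg_lt_one hs

theorem one_add_mul_geomConst {s : ℝ} (hs : 0 < s) :
    1 + (2 : ℝ≥0∞) ^ (-s) * geomConst s = geomConst s := by
  have h := two_rpow_neg_lt_one hs
  have h1 : (1 - (2 : ℝ≥0∞) ^ (-s)) * geomConst s = 1 := by
    rw [geomConst, ENNReal.mul_inv_cancel]
    · rw [Ne, tsub_eq_zero_iff_le, not_le]; exact h
    · exact ne_top_of_le_ne_top ENNReal.one_ne_top tsub_le_self
  calc 1 + (2 : ℝ≥0∞) ^ (-s) * geomConst s
      = (1 - (2 : ℝ≥0∞) ^ (-s)) * geomConst s + (2 : ℝ≥0∞) ^ (-s) * geomConst s := by rw [h1]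
    _ = geomConst s := by rw [← add_mul, tsub_add_cancel_of_le h.le, one_mul]

theorem sum_rpow_le_of_doubling {s : ℝ} (hs : 0 < s) (A : ι → ℝ≥0∞) (T : Finset ι)
    (hfin : ∀ F ∈ T, A F ≠ ∞)
    (hd : ∀ F ∈ T, ∀ G ∈ T, F ≠ G → 2 * A F ≤ A G ∨ 2 * A G ≤ A F)
    (B : ℝ≥0∞) (hB : ∀ F ∈ T, A F ≤ B) : ∑ F ∈ T, A F ^ s ≤ geomConst s * B ^ s := by
  induction T using Finset.induction_on_max_value A generalizing B with
  | empty => simp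
  | insert a T haT hmax ih =>
    have h2 : ∀ F ∈ T, A F ≤ A a / 2 := fun F hF => by
      rw [ENNReal.le_div_iff_mul_le (by simp) (by simp), mul_comm]
      rcases hd F (by simp [hF]) a (by simp) (fun h => haT (h ▸ hF)) with h | h
      · exact h
      · have : A a = 0 := by
          by_contra h0
          have hfa := hfin a (by simp)
          have : A a < 2 * A a := by
            rw [two_mul]; exact ENNReal.lt_add_right hfa h0
          exact absurd (h.trans (hmax F hF)) this.not_ge
        have h0 : A F = 0 := le_antisymm (this ▸ hmax F hF) zero_le
        simp [h0]
    have hih := ih (fun F hF => hfin F (by simp [hF]))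
      (fun F hF G hG => hd F (by simp [hF]) G (by simp [hG])) _ h2
    have hdiv : (A a / 2) ^ s = (2 : ℝ≥0∞) ^ (-s) * A a ^ s := by
      rw [ENNReal.div_rpow_of_nonneg _ _ hs.le, ENNReal.rpow_neg, div_eq_mul_inv, mul_comm]
    rw [Finset.sum_insert haT]
    calc A a ^ s + ∑ F ∈ T, A F ^ s
        ≤ A a ^ s + geomConst s * ((2 : ℝ≥0∞) ^ (-s) * A a ^ s) := by
          rw [← hdiv]; gcongr
      _ = (1 + (2 : ℝ≥0∞) ^ (-s) * geomConst s) * A a ^ s := by ring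
      _ = geomConst s * A a ^ s := by rw [one_add_mul_geomConst hs]
      _ ≤ geomConst s * B ^ s := by
          gcongr
          exact hB a (by simp)

theorem rpow_sum_rpow_le_of_doubling {s r : ℝ} (hs : 0 < s) (hr : 0 < r) (A : ι → ℝ≥0∞)
    (T : Finset ι) (hfin : ∀ F ∈ T, A F ≠ ∞)
    (hd : ∀ F ∈ T, ∀ G ∈ T, F ≠ G → 2 * A F ≤ A G ∨ 2 * A G ≤ A F) :
    (∑ F ∈ T, A F ^ s) ^ r ≤ geomConst s ^ r * ∑ F ∈ T, A F ^ (s * r) := by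
  rcases T.eq_empty_or_nonempty with rfl | hne
  · simp [hr]
  · obtain ⟨F, hF, hmax⟩ := Finset.exists_max_image T A hne
    calc (∑ F ∈ T, A F ^ s) ^ r ≤ (geomConst s * A F ^ s) ^ r := by
          gcongr
          exact sum_rpow_le_of_doubling hs A T hfin hd _ hmax
      _ = geomConst s ^ r * A F ^ (s * r) := by
          rw [ENNReal.mul_rpow_of_nonneg _ _ hr.le, ENNReal.rpow_mul]
      _ ≤ geomConst s ^ r * ∑ F ∈ T, A F ^ (s * r) := by
          gcongr
          exact Finset.single_le_sum (f := fun F => A F ^ (s * r)) (fun _ _ => zero_le) hF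

theorem rpow_sum_le_sum_rpow {r : ℝ} (hr : 0 < r) (hr1 : r ≤ 1) (T : Finset ι)
    (x : ι → ℝ≥0∞) : (∑ i ∈ T, x i) ^ r ≤ ∑ i ∈ T, x i ^ r := by
  induction T using Finset.induction_on with
  | empty => simp [hr]
  | insert a T ha ih =>
    rw [Finset.sum_insert ha, Finset.sum_insert ha]
    exact (ENNReal.rpow_add_le_add_rpow _ _ hr.le hr1).trans (by gcongr)

theorem sum_rpow_le_rpow_sum {r : ℝ} (hr : 1 ≤ r) (T : Finset ι)
    (x : ι → ℝ≥0∞) : ∑ i ∈ T, x i ^ r ≤ (∑ i ∈ T, x i) ^ r := by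
  induction T using Finset.induction_on with
  | empty => simp
  | insert a T ha ih =>
    rw [Finset.sum_insert ha, Finset.sum_insert ha]
    exact le_trans (by gcongr) (ENNReal.add_rpow_le_rpow_add _ _ hr)

theorem le_rpow_of_le_mul_rpow {q q' : ℝ} (hq : q.HolderConjugate q') {S c : ℝ≥0∞}
    (hS : S ≠ ∞) (h : S ≤ c * S ^ (1 / q')) : S ≤ c ^ q := by
  by_cases h0 : S = 0
  · simp [h0]
  have hsum : 1 / q + 1 / q' = 1 := by
    simpa [one_div] using hq.inv_add_inv_eq_one
  have h1 : S ^ (1 / q) * S ^ (1 / q') ≤ c * S ^ (1 / q') := by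
    rwa [← ENNReal.rpow_add _ _ h0 hS, hsum, ENNReal.rpow_one]
  have h2 : S ^ (1 / q) ≤ c := by
    refine (ENNReal.mul_le_mul_iff_left ?_ ?_).1 h1
    · simp [h0, hS]
    · exact ENNReal.rpow_ne_top_of_nonneg (by simpa using hq.symm.nonneg) hS
  calc S = (S ^ (1 / q)) ^ q := by
        rw [← ENNReal.rpow_mul, one_div_mul_cancel hq.ne_zero, ENNReal.rpow_one]
    _ ≤ c ^ q := ENNReal.rpow_le_rpow h2 hq.nonneg

theorem sum_mul_rpow_le {q q' : ℝ} (hq : q.HolderConjugate q') (T : Finset ι)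
    (A N x : ι → ℝ≥0∞) :
    ∑ F ∈ T, A F * N F ^ (1 / q) * x F ^ (1 / q')
      ≤ (∑ F ∈ T, A F ^ q * N F) ^ (1 / q) * (∑ F ∈ T, x F) ^ (1 / q') := by
  refine (ENNReal.inner_le_Lp_mul_Lq T _ _ hq).trans (le_of_eq ?_)
  congr 3 with F
  · rw [ENNReal.mul_rpow_of_nonneg _ _ hq.nonneg, ← ENNReal.rpow_mul,
      one_div_mul_cancel hq.ne_zero, ENNReal.rpow_one]
  · rw [← ENNReal.rpow_mul, one_div_mul_cancel hq.symm.ne_zero, ENNReal.rpow_one]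

/-- The Hölder step common to both halves of the argument. -/
theorem sum_stopping_le {q q' : ℝ} (hq : q.HolderConjugate q') (T : Finset ι)
    (A N x y : ι → ℝ≥0∞) (hx : ∑ F ∈ T, x F ≤ 1)
    (hy : ∑ F ∈ T, y F ≤ ∑ F ∈ T, A F ^ q * N F) :
    ∑ F ∈ T, A F * N F ^ (1 / q) * (x F ^ (1 / q') + y F ^ (1 / q'))
      ≤ (∑ F ∈ T, A F ^ q * N F) ^ (1 / q) + ∑ F ∈ T, A F ^ q * N F := by
  have hsum : 1 / q + 1 / q' = 1 := by
    simpa [one_div] using hq.inv_add_inv_eq_one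
  have hq1 : 0 ≤ 1 / q := by simpa using hq.nonneg
  have hq'1 : 0 ≤ 1 / q' := by simpa using hq.symm.nonneg
  simp only [mul_add, Finset.sum_add_distrib]
  refine add_le_add ((sum_mul_rpow_le hq T A N x).trans ?_)
    ((sum_mul_rpow_le hq T A N y).trans ?_)
  · refine mul_le_of_le_one_right' ?_
    exact ENNReal.rpow_le_one hx hq'1
  · calc _ ≤ (∑ F ∈ T, A F ^ q * N F) ^ (1 / q) * (∑ F ∈ T, A F ^ q * N F) ^ (1 / q') := by
          gcongr
      _ = ∑ F ∈ T, A F ^ q * N F := by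
          rw [← ENNReal.rpow_add_of_nonneg _ _ hq1 hq'1, hsum, ENNReal.rpow_one]

end Sums

section Cubes

variable {n : ℕ}

/-- Dyadic cubes, ordered by inclusion. -/
def DyCube (n : ℕ) := CubeIdx n

theorem mem_dyadicCube_iff {k : ℤ} {m : Fin n → ℤ} {x : Fin n → ℝ} :
    x ∈ dyadicCube n k m ↔ ∀ i, ⌊(2 : ℝ) ^ k * x i⌋ = m i := by
  have h2 : (0 : ℝ) < 2 ^ k := by positivity
  refine forall_congr' fun i => ?_
  rw [Int.floor_eq_iff, Set.mem_Ico, zpow_neg, inv_mul_le_iff₀ h2, lt_inv_mul_iff₀ h2]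

theorem floor_zpow_mul {k l : ℤ} (h : l ≤ k) (x : ℝ) :
    ⌊(2 : ℝ) ^ l * x⌋ = ⌊(2 : ℝ) ^ k * x⌋ / ((2 ^ (k - l).toNat : ℕ) : ℤ) := by
  rw [← Int.floor_div_natCast]
  congr 1
  have : ((2 : ℝ) ^ (k - l).toNat) = 2 ^ k / 2 ^ l := by
    rw [← zpow_natCast, Int.toNat_of_nonneg (by omega), zpow_sub₀ (by norm_num)]
  push_cast
  rw [this]
  field_simp

theorem idxCube_subset_of_mem {Q R : CubeIdx n} (h : R.1 ≤ Q.1) {x : Fin n → ℝ}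
    (hQ : x ∈ idxCube n Q) (hR : x ∈ idxCube n R) : idxCube n Q ⊆ idxCube n R := by
  intro y hy
  rw [idxCube, mem_dyadicCube_iff] at *
  intro i
  rw [← hR i, floor_zpow_mul h, floor_zpow_mul h, hy i, hQ i]

theorem idxCube_nonempty (Q : CubeIdx n) : (idxCube n Q).Nonempty := by
  refine ⟨fun i => 2 ^ (-Q.1) * (Q.2 i : ℝ), ?_⟩
  rw [idxCube, mem_dyadicCube_iff]
  intro i
  rw [← mul_assoc, ← zpow_add₀ (by norm_num)]
  simp

instance : PartialOrder (DyCube n) where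
  le Q R := R.1 ≤ Q.1 ∧ idxCube n Q ⊆ idxCube n R
  le_refl Q := ⟨le_rfl, Subset.rfl⟩
  le_trans Q R S h h' := ⟨h'.1.trans h.1, h.2.trans h'.2⟩
  le_antisymm Q R h h' := by
    have h1 : Q.1 = R.1 := le_antisymm h'.1 h.1
    obtain ⟨x, hx⟩ := idxCube_nonempty (n := n) Q
    have hR := mem_dyadicCube_iff.1 (h.2 hx)
    have hQ := mem_dyadicCube_iff.1 hx
    refine Prod.ext h1 (funext fun i => ?_)
    rw [← hQ i, ← hR i, h1]

theorem DyCube.le_or_le_of_mem {Q R : DyCube n} {x : Fin n → ℝ} (hQ : x ∈ idxCube n Q)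
    (hR : x ∈ idxCube n R) : Q ≤ R ∨ R ≤ Q := by
  rcases le_total R.1 Q.1 with h | h
  · exact Or.inl ⟨h, idxCube_subset_of_mem h hQ hR⟩
  · exact Or.inr ⟨h, idxCube_subset_of_mem h hR hQ⟩

theorem DyCube.isForest : IsForest (DyCube n) := by
  intro Q R S hR hS
  obtain ⟨x, hx⟩ := idxCube_nonempty (n := n) Q
  exact DyCube.le_or_le_of_mem (hR.2 hx) (hS.2 hx)

theorem measurableSet_dyadicCube (k : ℤ) (m : Fin n → ℤ) :
    MeasurableSet (dyadicCube n k m) := by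
  have : dyadicCube n k m = ⋂ i, (fun x : Fin n → ℝ => x i) ⁻¹'
      Set.Ico ((2:ℝ) ^ (-k) * (m i : ℝ)) ((2:ℝ) ^ (-k) * ((m i : ℝ) + 1)) := by
    ext x; simp [dyadicCube]
  rw [this]
  exact MeasurableSet.iInter fun i => measurable_pi_apply i measurableSet_Ico

theorem measurableSet_idxCube (Q : CubeIdx n) : MeasurableSet (idxCube n Q) :=
  measurableSet_dyadicCube _ _

theorem measurableSet_carlesonBox (k : ℤ) (m : Fin n → ℤ) :
    MeasurableSet (carlesonBox n k m) :=
  (measurableSet_dyadicCube k m).prod measurableSet_Ioc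

theorem measure_idxCube_lt_top (ω : Measure (Fin n → ℝ)) [IsLocallyFiniteMeasure ω]
    (Q : CubeIdx n) : ω (idxCube n Q) < ∞ := by
  refine lt_of_le_of_lt (measure_mono (t := Set.Icc (fun i => (2:ℝ) ^ (-Q.1) * (Q.2 i : ℝ))
    (fun i => (2:ℝ) ^ (-Q.1) * ((Q.2 i : ℝ) + 1))) ?_) isCompact_Icc.measure_lt_top
  intro x hx
  exact ⟨fun i => (hx i).1, fun i => (hx i).2.le⟩

/-- The Carleson box of a cube. -/
def cbox (Q : DyCube n) : Set ((Fin n → ℝ) × ℝ) := carlesonBox n Q.1 Q.2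

theorem measurableSet_cbox (Q : DyCube n) : MeasurableSet (cbox Q) :=
  measurableSet_carlesonBox _ _

theorem cbox_mono {Q R : DyCube n} (h : Q ≤ R) : cbox Q ⊆ cbox R := by
  rintro ⟨x, t⟩ ⟨hx, ht⟩
  refine ⟨h.2 hx, ht.1, ht.2.trans ?_⟩
  exact zpow_le_zpow_right₀ (by norm_num) (neg_le_neg h.1)

theorem mem_idxCube_of_mem_cbox {Q : DyCube n} {z : (Fin n → ℝ) × ℝ} (h : z ∈ cbox Q) :
    z.1 ∈ idxCube n Q := h.1

theorem DyCube.le_or_le_of_mem_cbox {Q R : DyCube n} {z : (Fin n → ℝ) × ℝ} (hQ : z ∈ cbox Q)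
    (hR : z ∈ cbox R) : Q ≤ R ∨ R ≤ Q :=
  DyCube.le_or_le_of_mem (mem_idxCube_of_mem_cbox hQ) (mem_idxCube_of_mem_cbox hR)

end Cubes

section Pairing

variable {n : ℕ}

theorem measurable_slice {f : (Fin n → ℝ) × ℝ → ℝ≥0∞} (hf : Measurable f) (t : ℝ) :
    Measurable fun x => f (x, t) :=
  hf.comp (measurable_id.prodMk measurable_const)

theorem measurable_vertL2 {f : (Fin n → ℝ) × ℝ → ℝ≥0∞} (hf : Measurable f) :
    Measurable (vertL2 n f) := by
  unfold vertL2
  exact (Measurable.tsum fun k => (measurable_slice hf _).pow_const 2).pow_const _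

theorem measurable_boxFn {μ : (Fin n → ℝ) × ℝ → ℝ≥0∞} (hμ : Measurable μ) (k : ℤ)
    (m : Fin n → ℤ) : Measurable (boxFn n μ k m) :=
  hμ.indicator (measurableSet_carlesonBox k m)

theorem vertL2_sq (f : (Fin n → ℝ) × ℝ → ℝ≥0∞) (x : Fin n → ℝ) :
    vertL2 n f x ^ 2 = ∑' k : ℤ, f (x, (2:ℝ) ^ (-k)) ^ 2 := by
  rw [vertL2, ← ENNReal.rpow_natCast, ← ENNReal.rpow_mul]
  norm_num

theorem vertL2_rpow (f : (Fin n → ℝ) × ℝ → ℝ≥0∞) (x : Fin n → ℝ) (q : ℝ) :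
    vertL2 n f x ^ q = (∑' k : ℤ, f (x, (2:ℝ) ^ (-k)) ^ 2) ^ (q / 2) := by
  rw [vertL2, ← ENNReal.rpow_mul]
  congr 1
  ring

theorem vertL2_mono {f h : (Fin n → ℝ) × ℝ → ℝ≥0∞} {x : Fin n → ℝ}
    (hfh : ∀ t, f (x, t) ≤ h (x, t)) : vertL2 n f x ≤ vertL2 n h x := by
  unfold vertL2
  gcongr
  exact hfh _

theorem vertL2_weight_mul (c : (Fin n → ℝ) → ℝ≥0∞) (f : (Fin n → ℝ) × ℝ → ℝ≥0∞)
    (x : Fin n → ℝ) : vertL2 n (fun z => c z.1 * f z) x = c x * vertL2 n f x := by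
  simp only [vertL2, mul_pow, ENNReal.tsum_mul_left]
  rw [ENNReal.mul_rpow_of_nonneg _ _ (by norm_num), ← ENNReal.rpow_natCast, ← ENNReal.rpow_mul]
  norm_num

/-- The pairing `∑_k ∫ f_k h_k dσ`. -/
def vertPair (σ : Measure (Fin n → ℝ)) (f h : (Fin n → ℝ) × ℝ → ℝ≥0∞) : ℝ≥0∞ :=
  ∫⁻ x, ∑' k : ℤ, f (x, (2:ℝ) ^ (-k)) * h (x, (2:ℝ) ^ (-k)) ∂σ

theorem boxInt_eq_vertPair (σ : Measure (Fin n → ℝ)) {μ f : (Fin n → ℝ) × ℝ → ℝ≥0∞}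
    (hμ : Measurable μ) (hf : Measurable f) (k : ℤ) (m : Fin n → ℤ) :
    boxInt n σ μ f k m = vertPair σ f (boxFn n μ k m) := by
  have hmeas : ∀ j : ℤ, AEMeasurable
      (fun x => f (x, (2:ℝ) ^ (-j)) * boxFn n μ k m (x, (2:ℝ) ^ (-j))) σ := fun j =>
    ((measurable_slice hf _).mul (measurable_slice (measurable_boxFn hμ k m) _)).aemeasurable
  rw [vertPair, lintegral_tsum hmeas, boxInt, ← (Equiv.neg ℤ).tsum_eq]
  refine tsum_congr fun j => ?_
  simp only [Equiv.neg_apply]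
  have h2 : (0 : ℝ) < 2 ^ (-j) := by positivity
  split_ifs with h
  · rw [← lintegral_indicator (measurableSet_dyadicCube k m)]
    refine lintegral_congr fun x => ?_
    by_cases hx : x ∈ dyadicCube n k m
    · rw [indicator_of_mem hx, boxFn, indicator_of_mem]
      exact ⟨hx, h2, h⟩
    · rw [indicator_of_notMem hx, boxFn, indicator_of_notMem, mul_zero]
      exact fun hz => hx hz.1
  · rw [eq_comm, lintegral_eq_zero_iff']
    · refine Filter.Eventually.of_forall fun x => ?_
      have : boxFn n μ k m (x, (2:ℝ) ^ (-j)) = 0 := indicator_of_notMem (fun hz => h hz.2.2) _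
      simp only [this, mul_zero, Pi.zero_apply]
    · exact hmeas j

theorem tsum_mul_le_vertL2 (f h : (Fin n → ℝ) × ℝ → ℝ≥0∞) (x : Fin n → ℝ) :
    ∑' k : ℤ, f (x, (2:ℝ) ^ (-k)) * h (x, (2:ℝ) ^ (-k)) ≤ vertL2 n f x * vertL2 n h x := by
  have := ENNReal.lintegral_mul_le_Lp_mul_Lq (Measure.count : Measure ℤ)
    (Real.HolderConjugate.two_two) (f := fun k => f (x, (2:ℝ) ^ (-k)))
    (g := fun k => h (x, (2:ℝ) ^ (-k))) (measurable_of_countable _).aemeasurable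
    (measurable_of_countable _).aemeasurable
  simpa [lintegral_count, vertL2] using this

theorem vertPair_le (σ : Measure (Fin n → ℝ)) {p p' : ℝ} (hp : p.HolderConjugate p')
    {f h : (Fin n → ℝ) × ℝ → ℝ≥0∞} (hf : Measurable f) (hh : Measurable h) :
    vertPair σ f h ≤ mixedNorm n σ p f * mixedNorm n σ p' h :=
  (lintegral_mono fun x => tsum_mul_le_vertL2 f h x).trans
    (ENNReal.lintegral_mul_le_Lp_mul_Lq σ hp (measurable_vertL2 hf).aemeasurable
      (measurable_vertL2 hh).aemeasurable)

theorem mixedNorm_rpow (σ : Measure (Fin n → ℝ)) {q : ℝ} (hq : 0 < q)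
    (f : (Fin n → ℝ) × ℝ → ℝ≥0∞) :
    mixedNorm n σ q f ^ q = ∫⁻ x, vertL2 n f x ^ q ∂σ := by
  rw [mixedNorm, ← ENNReal.rpow_mul, one_div_mul_cancel hq.ne', ENNReal.rpow_one]

theorem lpNorm_rpow (ω : Measure (Fin n → ℝ)) {q : ℝ} (hq : 0 < q)
    (g : (Fin n → ℝ) → ℝ≥0∞) : _root_.lpNorm n ω q g ^ q = ∫⁻ x, g x ^ q ∂ω := by
  rw [_root_.lpNorm, ← ENNReal.rpow_mul, one_div_mul_cancel hq.ne', ENNReal.rpow_one]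

theorem boxFn_mul_boxFn (μ : (Fin n → ℝ) × ℝ → ℝ≥0∞) {Q R : DyCube n} (h : Q ≤ R)
    (z : (Fin n → ℝ) × ℝ) :
    boxFn n μ R.1 R.2 z * boxFn n μ Q.1 Q.2 z = boxFn n μ Q.1 Q.2 z ^ 2 := by
  by_cases hz : z ∈ cbox Q
  · have hz' := cbox_mono h hz
    unfold cbox at hz hz'
    rw [boxFn, boxFn, indicator_of_mem hz, indicator_of_mem hz', sq]
  · unfold cbox at hz
    simp [boxFn, indicator_of_notMem hz]

theorem boxFn_mono (μ : (Fin n → ℝ) × ℝ → ℝ≥0∞) {Q R : DyCube n} (h : Q ≤ R)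
    (z : (Fin n → ℝ) × ℝ) : boxFn n μ Q.1 Q.2 z ≤ boxFn n μ R.1 R.2 z :=
  indicator_le_indicator_of_subset (cbox_mono h) (fun _ => zero_le) z

theorem vertL2_boxFn_of_notMem (μ : (Fin n → ℝ) × ℝ → ℝ≥0∞) {Q : DyCube n} {x : Fin n → ℝ}
    (h : x ∉ idxCube n Q) : vertL2 n (boxFn n μ Q.1 Q.2) x = 0 := by
  have : ∀ t, boxFn n μ Q.1 Q.2 (x, t) = 0 := fun t =>
    indicator_of_notMem (fun hz => h hz.1) _
  simp [vertL2, this]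

/-- The horizontal factor `|1_{Q̂} μ|_{ℓ²}^{p'-2}` of the test function. -/
def testWeight (p' : ℝ) (μ : (Fin n → ℝ) × ℝ → ℝ≥0∞)
    (Q : DyCube n) (x : Fin n → ℝ) :
    ℝ≥0∞ :=
  if vertL2 n (boxFn n μ Q.1 Q.2) x = 0 then 0 else vertL2 n (boxFn n μ Q.1 Q.2) x ^ (p' - 2)

theorem testFn_eq (p' : ℝ) (μ : (Fin n → ℝ) × ℝ → ℝ≥0∞) (Q : DyCube n) :
    testFn n p' μ Q.1 Q.2 = fun z => testWeight p' μ Q z.1 * boxFn n μ Q.1 Q.2 z := by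
  ext z
  rw [testFn, testWeight]
  split_ifs <;> simp

theorem measurable_testWeight (p' : ℝ) {μ : (Fin n → ℝ) × ℝ → ℝ≥0∞} (hμ : Measurable μ)
    (Q : DyCube n) : Measurable (testWeight p' μ Q) := by
  have := measurable_vertL2 (measurable_boxFn hμ Q.1 Q.2)
  unfold testWeight
  exact Measurable.ite (this (measurableSet_singleton 0)) measurable_const (this.pow_const _)

theorem measurable_testFn (p' : ℝ) {μ : (Fin n → ℝ) × ℝ → ℝ≥0∞} (hμ : Measurable μ)
    (Q : DyCube n) : Measurable (testFn n p' μ Q.1 Q.2) := by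
  rw [testFn_eq]
  exact ((measurable_testWeight p' hμ Q).comp measurable_fst).mul (measurable_boxFn hμ _ _)

/-- The `p'`-th power of `‖1_{Q̂} μ‖_{L^{p'}(σ;ℓ²)}`. -/
def boxMass (σ : Measure (Fin n → ℝ)) (p' : ℝ) (μ : (Fin n → ℝ) × ℝ → ℝ≥0∞)
    (Q : DyCube n) : ℝ≥0∞ :=
  ∫⁻ x, vertL2 n (boxFn n μ Q.1 Q.2) x ^ p' ∂σ

theorem boxInt_testFn (σ : Measure (Fin n → ℝ)) (p' : ℝ) {μ : (Fin n → ℝ) × ℝ → ℝ≥0∞}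
    (hμ : Measurable μ) {Q F : DyCube n} (h : Q ≤ F) :
    boxInt n σ μ (testFn n p' μ F.1 F.2) Q.1 Q.2
      = ∫⁻ x, testWeight p' μ F x * vertL2 n (boxFn n μ Q.1 Q.2) x ^ 2 ∂σ := by
  rw [boxInt_eq_vertPair σ hμ (measurable_testFn p' hμ F), vertPair, testFn_eq]
  refine lintegral_congr fun x => ?_
  simp only [mul_assoc, boxFn_mul_boxFn μ h]
  rw [ENNReal.tsum_mul_left, vertL2_sq]

theorem vertL2_testFn_le {p' : ℝ} (hp1 : 1 < p') (μ : (Fin n → ℝ) × ℝ → ℝ≥0∞)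
    (Q : DyCube n) (x : Fin n → ℝ) :
    vertL2 n (testFn n p' μ Q.1 Q.2) x ≤ vertL2 n (boxFn n μ Q.1 Q.2) x ^ (p' - 1) := by
  rw [testFn_eq, vertL2_weight_mul, testWeight]
  set M := vertL2 n (boxFn n μ Q.1 Q.2) x
  split_ifs with h0
  · simp
  by_cases ht : M = ∞
  · rw [ht, ENNReal.top_rpow_of_pos (y := p' - 1) (by linarith)]
    exact le_top
  · rw [show p' - 1 = (p' - 2) + 1 by ring, ENNReal.rpow_add _ _ h0 ht, ENNReal.rpow_one]

theorem mixedNorm_testFn_le (σ : Measure (Fin n → ℝ)) {p p' : ℝ} (hp : p.HolderConjugate p')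
    (μ : (Fin n → ℝ) × ℝ → ℝ≥0∞) (Q : DyCube n) :
    mixedNorm n σ p (testFn n p' μ Q.1 Q.2) ≤ boxMass σ p' μ Q ^ (1 / p) := by
  have h : (p' - 1) * p = p' := by
    have := hp.symm.sub_one_mul_conj
    linarith
  unfold mixedNorm boxMass
  refine ENNReal.rpow_le_rpow (lintegral_mono fun x => ?_) (by simpa using hp.nonneg)
  calc vertL2 n (testFn n p' μ Q.1 Q.2) x ^ p
      ≤ (vertL2 n (boxFn n μ Q.1 Q.2) x ^ (p' - 1)) ^ p :=
        ENNReal.rpow_le_rpow (vertL2_testFn_le hp.symm.lt μ Q x) hp.nonneg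
    _ = _ := by rw [← ENNReal.rpow_mul, h]

theorem ae_vertL2_boxFn_lt_top (σ : Measure (Fin n → ℝ)) {p' : ℝ} (hp : 0 < p')
    {μ : (Fin n → ℝ) × ℝ → ℝ≥0∞} (hμ : Measurable μ) {Q : DyCube n}
    (h : boxMass σ p' μ Q ≠ ∞) : ∀ᵐ x ∂σ, vertL2 n (boxFn n μ Q.1 Q.2) x ≠ ∞ := by
  have := ae_lt_top ((measurable_vertL2 (measurable_boxFn hμ Q.1 Q.2)).pow_const p') h
  filter_upwards [this] with x hx ht
  rw [ht, ENNReal.top_rpow_of_pos hp] at hx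
  exact lt_irrefl _ hx

theorem boxMass_le_boxInt_testFn (σ : Measure (Fin n → ℝ)) {p' : ℝ} (hp : 0 < p')
    {μ : (Fin n → ℝ) × ℝ → ℝ≥0∞} (hμ : Measurable μ) {Q : DyCube n}
    (h : boxMass σ p' μ Q ≠ ∞) :
    boxMass σ p' μ Q ≤ boxInt n σ μ (testFn n p' μ Q.1 Q.2) Q.1 Q.2 := by
  rw [boxInt_testFn σ p' hμ le_rfl, boxMass]
  refine lintegral_mono_ae ?_
  filter_upwards [ae_vertL2_boxFn_lt_top σ hp hμ h] with x hx
  rw [testWeight]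
  split_ifs with h0
  · simp [h0, hp]
  · rw [← ENNReal.rpow_natCast, ← ENNReal.rpow_add _ _ h0 hx]
    norm_num

theorem boxInt_le (σ : Measure (Fin n → ℝ)) {p p' : ℝ} (hp : p.HolderConjugate p')
    {μ f : (Fin n → ℝ) × ℝ → ℝ≥0∞} (hμ : Measurable μ) (hf : Measurable f) (Q : DyCube n) :
    boxInt n σ μ f Q.1 Q.2 ≤ mixedNorm n σ p f * boxMass σ p' μ Q ^ (1 / p') := by
  rw [boxInt_eq_vertPair σ hμ hf]
  exact vertPair_le σ hp hf (measurable_boxFn hμ _ _)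

end Pairing

section Embedding

variable {n : ℕ}

theorem sum_le_of_eq_of_ne_zero {ι : Type*} {T : Finset ι} {x : ι → ℝ≥0∞} {B : ℝ≥0∞}
    (hB : ∀ G ∈ T, x G ≤ B)
    (h : ∀ G ∈ T, ∀ H ∈ T, x G ≠ 0 → x H ≠ 0 → G = H) : ∑ G ∈ T, x G ≤ B := by
  by_cases hex : ∃ G ∈ T, x G ≠ 0
  · obtain ⟨G, hG, hxG⟩ := hex
    rw [Finset.sum_eq_single_of_mem G hG]
    · exact hB G hG
    · intro H hH hne
      by_contra hxH
      exact hne (h H hH G hG hxH hxG)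
  · push Not at hex
    rw [Finset.sum_eq_zero hex]
    exact zero_le

theorem eq_of_mem_stopChildren_of_mem {𝓕 : Finset (DyCube n)} {F G H : DyCube n}
    (hG : G ∈ stopChildren 𝓕 F) (hH : H ∈ stopChildren 𝓕 F) {x : Fin n → ℝ}
    (hxG : x ∈ idxCube n G) (hxH : x ∈ idxCube n H) : G = H :=
  eq_of_mem_stopChildren hG hH (DyCube.le_or_le_of_mem hxG hxH)

theorem le_of_mem_stopChildren {ι : Type*} [PartialOrder ι] {𝓕 : Finset ι} {F G : ι}
    (hG : G ∈ stopChildren 𝓕 F) : G ≤ F :=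
  (mem_stopChildren.1 hG).2.2.1.le

theorem mem_idxCube_of_vertL2_ne_zero {μ : (Fin n → ℝ) × ℝ → ℝ≥0∞} {Q : DyCube n}
    {x : Fin n → ℝ} (h : vertL2 n (boxFn n μ Q.1 Q.2) x ≠ 0) : x ∈ idxCube n Q := by
  by_contra hx
  exact h (vertL2_boxFn_of_notMem μ hx)

theorem mem_cbox_of_boxFn_ne_zero {μ : (Fin n → ℝ) × ℝ → ℝ≥0∞} {Q : DyCube n}
    {z : (Fin n → ℝ) × ℝ} (h : boxFn n μ Q.1 Q.2 z ≠ 0) : z ∈ cbox Q :=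
  mem_of_indicator_ne_zero h

theorem rpow_le_add_mul_testWeight {p' : ℝ} (hp : 1 < p') (μ : (Fin n → ℝ) × ℝ → ℝ≥0∞)
    {G F : DyCube n} (h : G ≤ F) {x : Fin n → ℝ}
    (hx : vertL2 n (boxFn n μ F.1 F.2) x ≠ ∞) {D : ℝ≥0∞} (hD : 1 ≤ D) (hDt : D ≠ ∞) :
    vertL2 n (boxFn n μ G.1 G.2) x ^ p'
      ≤ D⁻¹ * vertL2 n (boxFn n μ F.1 F.2) x ^ p'
        + D * (testWeight p' μ F x * vertL2 n (boxFn n μ G.1 G.2) x ^ 2) := by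
  have hle : vertL2 n (boxFn n μ G.1 G.2) x ≤ vertL2 n (boxFn n μ F.1 F.2) x :=
    vertL2_mono fun t => boxFn_mono μ h (x, t)
  rw [testWeight]
  generalize vertL2 n (boxFn n μ G.1 G.2) x = M' at *
  generalize vertL2 n (boxFn n μ F.1 F.2) x = M at *
  have hD0 : D ≠ 0 := (zero_lt_one.trans_le hD).ne'
  split_ifs with h0
  · have : M' = 0 := le_antisymm (h0 ▸ hle) zero_le
    simp [this, zero_lt_one.trans hp]
  rcases le_or_gt M' (D⁻¹ * M) with hc | hc
  · refine le_trans ?_ le_self_add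
    calc M' ^ p' ≤ (D⁻¹ * M) ^ p' := ENNReal.rpow_le_rpow hc (by linarith)
      _ = D⁻¹ ^ p' * M ^ p' := ENNReal.mul_rpow_of_nonneg _ _ (by linarith)
      _ ≤ D⁻¹ * M ^ p' := by
        gcongr
        exact ENNReal.rpow_le_self_of_le_one (ENNReal.inv_le_one.2 hD) hp.le
  · refine le_trans ?_ le_add_self
    calc M' ^ p' = M' * M' ^ (p' - 1) := by
          conv_lhs => rw [show p' = 1 + (p' - 1) by ring]
          rw [ENNReal.rpow_add_of_nonneg _ _ zero_le_one (by linarith), ENNReal.rpow_one]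
      _ ≤ M' * M ^ (p' - 1) := by
          gcongr
      _ = M' * (M ^ (p' - 2) * M) := by
          rw [show p' - 1 = (p' - 2) + 1 by ring, ENNReal.rpow_add _ _ h0 hx, ENNReal.rpow_one]
      _ = D * (M ^ (p' - 2) * (M' * (D⁻¹ * M))) := by
          have : D * D⁻¹ = 1 := ENNReal.mul_inv_cancel hD0 hDt
          calc _ = (D * D⁻¹) * (M' * (M ^ (p' - 2) * M)) := by rw [this, one_mul]
            _ = _ := by ring
      _ ≤ D * (M ^ (p' - 2) * M' ^ 2) := by
          rw [sq]
          gcongr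

theorem sum_boxMass_stopChildren_le (σ : Measure (Fin n → ℝ)) {p' : ℝ} (hp : 1 < p')
    {μ : (Fin n → ℝ) × ℝ → ℝ≥0∞} (hμ : Measurable μ) {𝓕 : Finset (DyCube n)} {F : DyCube n}
    (hN : boxMass σ p' μ F ≠ ∞) {D : ℝ≥0∞} (hD : 1 ≤ D) (hDt : D ≠ ∞) :
    ∑ G ∈ stopChildren 𝓕 F, boxMass σ p' μ G ≤ D⁻¹ * boxMass σ p' μ F
      + D * ∑ G ∈ stopChildren 𝓕 F, boxInt n σ μ (testFn n p' μ F.1 F.2) G.1 G.2 := by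
  have hM : ∀ G : DyCube n, Measurable (vertL2 n (boxFn n μ G.1 G.2)) := fun G =>
    measurable_vertL2 (measurable_boxFn hμ _ _)
  have hm2 : ∀ G : DyCube n, Measurable fun x =>
      testWeight p' μ F x * vertL2 n (boxFn n μ G.1 G.2) x ^ 2 := fun G =>
    (measurable_testWeight p' hμ F).mul ((hM G).pow_const 2)
  have e : ∑ G ∈ stopChildren 𝓕 F, boxInt n σ μ (testFn n p' μ F.1 F.2) G.1 G.2
      = ∫⁻ x, ∑ G ∈ stopChildren 𝓕 F,
          testWeight p' μ F x * vertL2 n (boxFn n μ G.1 G.2) x ^ 2 ∂σ := by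
    rw [lintegral_finsetSum _ fun G _ => hm2 G]
    exact Finset.sum_congr rfl fun G hG => boxInt_testFn σ p' hμ (le_of_mem_stopChildren hG)
  rw [e]
  unfold boxMass
  rw [← lintegral_finsetSum _ fun G _ => (hM G).pow_const _, ← lintegral_const_mul _
    ((hM F).pow_const _), ← lintegral_const_mul _ (Finset.measurable_fun_sum _ fun G _ => hm2 G),
    ← lintegral_add_left (((hM F).pow_const _).const_mul _)]
  refine lintegral_mono_ae ?_
  filter_upwards [ae_vertL2_boxFn_lt_top σ (zero_lt_one.trans hp) hμ hN] with x hx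
  refine sum_le_of_eq_of_ne_zero (fun G hG => ?_) fun G hG H hH h1 h2 => ?_
  · refine (rpow_le_add_mul_testWeight hp μ (le_of_mem_stopChildren hG) hx hD hDt).trans ?_
    gcongr
    exact Finset.single_le_sum
      (f := fun G : DyCube n => testWeight p' μ F x * vertL2 n (boxFn n μ G.1 G.2) x ^ 2)
      (fun _ _ => zero_le) hG
  · refine eq_of_mem_stopChildren_of_mem hG hH (x := x) ?_ ?_
    · exact mem_idxCube_of_vertL2_ne_zero (μ := μ) fun h =>
        h1 (by rw [h, ENNReal.zero_rpow_of_pos (by linarith)])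
    · exact mem_idxCube_of_vertL2_ne_zero (μ := μ) fun h =>
        h2 (by rw [h, ENNReal.zero_rpow_of_pos (by linarith)])

theorem sum_boxInt_stopChildren_le (σ : Measure (Fin n → ℝ))
    {μ f : (Fin n → ℝ) × ℝ → ℝ≥0∞} (hμ : Measurable μ) (hf : Measurable f)
    (𝓕 : Finset (DyCube n)) (F : DyCube n) :
    ∑ G ∈ stopChildren 𝓕 F, boxInt n σ μ f G.1 G.2 ≤ boxInt n σ μ f F.1 F.2 := by
  simp only [boxInt_eq_vertPair σ hμ hf, vertPair]
  have hm : ∀ G : DyCube n, Measurable fun x => ∑' k : ℤ,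
      f (x, (2:ℝ) ^ (-k)) * boxFn n μ G.1 G.2 (x, (2:ℝ) ^ (-k)) := fun G =>
    Measurable.tsum fun k => (measurable_slice hf _).mul
      (measurable_slice (measurable_boxFn hμ _ _) _)
  rw [← lintegral_finsetSum _ fun G _ => hm G]
  refine lintegral_mono fun x => ?_
  rw [← Summable.tsum_finsetSum fun _ _ => ENNReal.summable]
  refine ENNReal.tsum_le_tsum fun k => ?_
  rw [← Finset.mul_sum]
  gcongr
  refine sum_le_of_eq_of_ne_zero (fun G hG => boxFn_mono μ (le_of_mem_stopChildren hG) _)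
    fun G hG H hH h1 h2 => eq_of_mem_stopChildren_of_mem hG hH
      (mem_cbox_of_boxFn_ne_zero h1).1 (mem_cbox_of_boxFn_ne_zero h2).1

/-- The average of `f` over `Q̂` relative to the test function of `Q`. -/
def boxAvg (σ : Measure (Fin n → ℝ)) (p' : ℝ) (μ f : (Fin n → ℝ) × ℝ → ℝ≥0∞)
    (Q : DyCube n) : ℝ≥0∞ :=
  boxInt n σ μ f Q.1 Q.2 / boxMass σ p' μ Q

theorem boxAvg_mul_boxMass (σ : Measure (Fin n → ℝ)) {p p' : ℝ} (hp : p.HolderConjugate p')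
    {μ f : (Fin n → ℝ) × ℝ → ℝ≥0∞} (hμ : Measurable μ) (hf : Measurable f) {Q : DyCube n}
    (hN : boxMass σ p' μ Q ≠ ∞) :
    boxAvg σ p' μ f Q * boxMass σ p' μ Q = boxInt n σ μ f Q.1 Q.2 := by
  by_cases h0 : boxMass σ p' μ Q = 0
  · have := boxInt_le σ hp hμ hf Q
    rw [h0, ENNReal.zero_rpow_of_pos (by simpa using hp.symm.pos), mul_zero] at this
    rw [h0, mul_zero, le_antisymm this zero_le]
  · exact ENNReal.div_mul_cancel h0 hN

theorem boxAvg_ne_top (σ : Measure (Fin n → ℝ)) {p p' : ℝ} (hp : p.HolderConjugate p')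
    {μ f : (Fin n → ℝ) × ℝ → ℝ≥0∞} (hμ : Measurable μ) (hf : Measurable f)
    (hfn : mixedNorm n σ p f ≠ ∞) {Q : DyCube n} (hN : boxMass σ p' μ Q ≠ ∞) :
    boxAvg σ p' μ f Q ≠ ∞ := by
  have hle := boxInt_le σ hp hμ hf Q
  have hp' : 0 < 1 / p' := by simpa using hp.symm.pos
  by_cases h0 : boxMass σ p' μ Q = 0
  · rw [h0, ENNReal.zero_rpow_of_pos hp', mul_zero] at hle
    rw [boxAvg, le_antisymm hle zero_le, ENNReal.zero_div]
    simp
  · refine ENNReal.div_ne_top (ne_top_of_le_ne_top ?_ hle) h0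
    exact ENNReal.mul_ne_top hfn (ENNReal.rpow_ne_top_of_nonneg hp'.le hN)

/-- The stopping condition for `f`. -/
def fOk (σ : Measure (Fin n → ℝ)) (p' : ℝ) (μ f : (Fin n → ℝ) × ℝ → ℝ≥0∞) (K : ℝ≥0∞)
    (F : DyCube n) (v : ℝ≥0∞) (Q : DyCube n) : Prop :=
  boxInt n σ μ f Q.1 Q.2 ≤ K * v * boxInt n σ μ (testFn n p' μ F.1 F.2) Q.1 Q.2

theorem sum_boxMass_le_of_not_fOk (σ : Measure (Fin n → ℝ)) {p p' : ℝ}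
    (hp : p.HolderConjugate p')
    {μ f : (Fin n → ℝ) × ℝ → ℝ≥0∞} (hμ : Measurable μ) (hf : Measurable f)
    {𝓕 : Finset (DyCube n)} {F : DyCube n} (hN : boxMass σ p' μ F ≠ ∞)
    {D : ℝ≥0∞} (hD : 1 ≤ D) (hDt : D ≠ ∞) {v : ℝ≥0∞} (hv : v ≠ ∞)
    (hav : boxAvg σ p' μ f F ≤ v)
    (hno : ∀ G ∈ stopChildren 𝓕 F, ¬ fOk σ p' μ f (D ^ 2) F v G) :
    ∑ G ∈ stopChildren 𝓕 F, boxMass σ p' μ G ≤ 2 * D⁻¹ * boxMass σ p' μ F := by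
  have hD0 : D ≠ 0 := (zero_lt_one.trans_le hD).ne'
  have hDD : D * D⁻¹ = 1 := ENNReal.mul_inv_cancel hD0 hDt
  have hu : ∑ G ∈ stopChildren 𝓕 F, boxInt n σ μ f G.1 G.2 ≤ v * boxMass σ p' μ F := by
    refine (sum_boxInt_stopChildren_le σ hμ hf 𝓕 F).trans ?_
    rw [← boxAvg_mul_boxMass σ hp hμ hf hN]
    gcongr
  by_cases hv0 : v = 0
  · have : stopChildren 𝓕 F = ∅ := by
      refine Finset.eq_empty_of_forall_notMem fun G hG => hno G hG ?_
      rw [hv0, zero_mul] at hu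
      exact (Finset.single_le_sum (f := fun G : DyCube n => boxInt n σ μ f G.1 G.2)
        (fun _ _ => zero_le) hG).trans (hu.trans zero_le)
    simp [this]
  have h1 : D ^ 2 * v * ∑ G ∈ stopChildren 𝓕 F, boxInt n σ μ (testFn n p' μ F.1 F.2) G.1 G.2
      ≤ v * boxMass σ p' μ F := by
    rw [Finset.mul_sum]
    exact (Finset.sum_le_sum fun G hG => (not_le.1 (hno G hG)).le).trans hu
  have h2 : D ^ 2 * ∑ G ∈ stopChildren 𝓕 F, boxInt n σ μ (testFn n p' μ F.1 F.2) G.1 G.2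
      ≤ boxMass σ p' μ F := by
    rw [mul_comm (D ^ 2) v, mul_assoc] at h1
    exact (ENNReal.mul_le_mul_iff_right hv0 hv).1 h1
  refine (sum_boxMass_stopChildren_le σ hp.symm.lt hμ hN hD hDt).trans ?_
  rw [two_mul, add_mul]
  refine add_le_add le_rfl ?_
  calc D * ∑ G ∈ stopChildren 𝓕 F, boxInt n σ μ (testFn n p' μ F.1 F.2) G.1 G.2
      = D⁻¹ * (D ^ 2 * ∑ G ∈ stopChildren 𝓕 F,
          boxInt n σ μ (testFn n p' μ F.1 F.2) G.1 G.2) := by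
        rw [sq, ← mul_assoc, ← mul_assoc, mul_comm D⁻¹ D, hDD, one_mul]
    _ ≤ _ := by gcongr

end Embedding

section FEmbedding

variable {n : ℕ}

theorem sum_mul_indicator_eq {ι α : Type*} (𝓕 : Finset ι) (s : ι → Set α) (A : ι → ℝ≥0∞)
    (μ : α → ℝ≥0∞) (z : α) :
    ∑ F ∈ 𝓕, A F * (s F).indicator μ z = (∑ F ∈ 𝓕 with z ∈ s F, A F) * μ z := by
  rw [Finset.sum_filter, Finset.sum_mul]
  refine Finset.sum_congr rfl fun F _ => ?_
  by_cases h : z ∈ s F <;> simp [h]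

theorem DyCube.lt_or_lt_of_mem {F G : DyCube n} (hne : F ≠ G) {x : Fin n → ℝ}
    (hF : x ∈ idxCube n F) (hG : x ∈ idxCube n G) : F < G ∨ G < F :=
  (DyCube.le_or_le_of_mem hF hG).imp (lt_of_le_of_ne · hne) (lt_of_le_of_ne · hne.symm)

theorem sq_sum_mul_boxFn_le {s : ℝ} (hs : 0 < s) (μ : (Fin n → ℝ) × ℝ → ℝ≥0∞)
    {𝓕 : Finset (DyCube n)} {A : DyCube n → ℝ≥0∞} (hfin : ∀ F ∈ 𝓕, A F ≠ ∞)
    (hd : ∀ F ∈ 𝓕, ∀ R ∈ 𝓕, F < R → 2 * A R ≤ A F) (z : (Fin n → ℝ) × ℝ) :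
    (∑ F ∈ 𝓕, A F ^ s * boxFn n μ F.1 F.2 z) ^ 2
      ≤ geomConst s ^ 2 * ∑ F ∈ 𝓕, A F ^ (s * 2) * boxFn n μ F.1 F.2 z ^ 2 := by
  have h := rpow_sum_rpow_le_of_doubling hs two_pos A {F ∈ 𝓕 | z ∈ cbox F}
    (fun F hF => hfin F (Finset.mem_filter.1 hF).1) fun F hF G hG hne => by
      rw [Finset.mem_filter] at hF hG
      rcases DyCube.lt_or_lt_of_mem hne hF.2.1 hG.2.1 with h | h
      · exact Or.inr (hd F hF.1 G hG.1 h)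
      · exact Or.inl (hd G hG.1 F hF.1 h)
  rw [ENNReal.rpow_two, ENNReal.rpow_two] at h
  have e1 : ∑ F ∈ 𝓕, A F ^ s * boxFn n μ F.1 F.2 z = (∑ F ∈ 𝓕 with z ∈ cbox F, A F ^ s) * μ z :=
    sum_mul_indicator_eq 𝓕 cbox (fun F => A F ^ s) μ z
  have e2 : ∑ F ∈ 𝓕, A F ^ (s * 2) * boxFn n μ F.1 F.2 z ^ 2
      = (∑ F ∈ 𝓕 with z ∈ cbox F, A F ^ (s * 2)) * μ z ^ 2 := by
    rw [← sum_mul_indicator_eq 𝓕 cbox (fun F => A F ^ (s * 2)) (fun z => μ z ^ 2) z]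
    refine Finset.sum_congr rfl fun F _ => ?_
    by_cases hz : z ∈ cbox F
    · rw [indicator_of_mem hz, boxFn, indicator_of_mem (by exact hz)]
    · rw [indicator_of_notMem hz, boxFn, indicator_of_notMem (by exact hz)]
      simp
  rw [e1, e2, mul_pow, ← mul_assoc]
  gcongr

theorem mixedNorm_sum_mul_boxFn_le (σ : Measure (Fin n → ℝ)) {p p' : ℝ}
    (hp : p.HolderConjugate p') (hp2 : p' ≤ 2) {μ : (Fin n → ℝ) × ℝ → ℝ≥0∞}
    (hμ : Measurable μ) {𝓕 : Finset (DyCube n)} {A : DyCube n → ℝ≥0∞}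
    (hfin : ∀ F ∈ 𝓕, A F ≠ ∞) (hd : ∀ F ∈ 𝓕, ∀ R ∈ 𝓕, F < R → 2 * A R ≤ A F) :
    mixedNorm n σ p' (fun z => ∑ F ∈ 𝓕, A F ^ (p - 1) * boxFn n μ F.1 F.2 z)
      ≤ geomConst (p - 1) * (∑ F ∈ 𝓕, A F ^ p * boxMass σ p' μ F) ^ (1 / p') := by
  have hs : 0 < p - 1 := hp.sub_one_pos
  have hp0 : 0 < p' := hp.symm.pos
  have hexp : (p - 1) * p' = p := hp.sub_one_mul_conj
  have hM : ∀ F : DyCube n, Measurable (vertL2 n (boxFn n μ F.1 F.2)) := fun F =>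
    measurable_vertL2 (measurable_boxFn hμ _ _)
  have key : ∀ x, vertL2 n (fun z => ∑ F ∈ 𝓕, A F ^ (p - 1) * boxFn n μ F.1 F.2 z) x ^ p'
      ≤ geomConst (p - 1) ^ p' * ∑ F ∈ 𝓕, A F ^ p * vertL2 n (boxFn n μ F.1 F.2) x ^ p' := by
    intro x
    calc vertL2 n (fun z => ∑ F ∈ 𝓕, A F ^ (p - 1) * boxFn n μ F.1 F.2 z) x ^ p'
        = (∑' k : ℤ, (∑ F ∈ 𝓕, A F ^ (p - 1) * boxFn n μ F.1 F.2 (x, (2:ℝ) ^ (-k))) ^ 2)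
            ^ (p' / 2) := vertL2_rpow _ _ _
      _ ≤ (∑' k : ℤ, geomConst (p - 1) ^ 2 * ∑ F ∈ 𝓕, A F ^ ((p - 1) * 2)
            * boxFn n μ F.1 F.2 (x, (2:ℝ) ^ (-k)) ^ 2) ^ (p' / 2) := by
          gcongr with k
          exact sq_sum_mul_boxFn_le hs μ hfin hd _
      _ = geomConst (p - 1) ^ p' * (∑ F ∈ 𝓕, A F ^ ((p - 1) * 2)
            * vertL2 n (boxFn n μ F.1 F.2) x ^ 2) ^ (p' / 2) := by
          rw [ENNReal.tsum_mul_left, Summable.tsum_finsetSum fun _ _ => ENNReal.summable,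
            ENNReal.mul_rpow_of_nonneg _ _ (by positivity), ← ENNReal.rpow_two,
            ← ENNReal.rpow_mul, mul_div_cancel₀ _ (two_ne_zero' ℝ)]
          congr 3 with F
          rw [ENNReal.tsum_mul_left, vertL2_sq]
      _ ≤ geomConst (p - 1) ^ p' * ∑ F ∈ 𝓕, (A F ^ ((p - 1) * 2)
            * vertL2 n (boxFn n μ F.1 F.2) x ^ 2) ^ (p' / 2) := by
          gcongr
          exact rpow_sum_le_sum_rpow (by positivity) (by linarith) _ _
      _ = _ := by
          congr 2 with F
          rw [ENNReal.mul_rpow_of_nonneg _ _ (by positivity), ← ENNReal.rpow_two,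
            ← ENNReal.rpow_mul, ← ENNReal.rpow_mul, mul_div_cancel₀ _ (two_ne_zero' ℝ), mul_assoc,
            mul_div_cancel₀ _ (two_ne_zero' ℝ), hexp]
  have hint : ∫⁻ x, vertL2 n (fun z => ∑ F ∈ 𝓕, A F ^ (p - 1) * boxFn n μ F.1 F.2 z) x ^ p' ∂σ
      ≤ geomConst (p - 1) ^ p' * ∑ F ∈ 𝓕, A F ^ p * boxMass σ p' μ F := by
    refine (lintegral_mono key).trans (le_of_eq ?_)
    rw [lintegral_const_mul _ (Finset.measurable_fun_sum _ fun F _ =>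
      ((hM F).pow_const _).const_mul _),
      lintegral_finsetSum _ fun F _ => ((hM F).pow_const _).const_mul _]
    congr 2 with F
    rw [lintegral_const_mul _ ((hM F).pow_const _), boxMass]
  calc _ ≤ (geomConst (p - 1) ^ p' * ∑ F ∈ 𝓕, A F ^ p * boxMass σ p' μ F) ^ (1 / p') :=
        ENNReal.rpow_le_rpow hint (by positivity)
    _ = _ := by
        rw [ENNReal.mul_rpow_of_nonneg _ _ (by positivity), ← ENNReal.rpow_mul,
          mul_one_div_cancel hp0.ne', ENNReal.rpow_one]

theorem sum_mul_boxInt_le (σ : Measure (Fin n → ℝ)) {p p' : ℝ}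
    (hp : p.HolderConjugate p') {μ f : (Fin n → ℝ) × ℝ → ℝ≥0∞}
    (hμ : Measurable μ) (hf : Measurable f) (𝓕 : Finset (DyCube n)) (c : DyCube n → ℝ≥0∞) :
    ∑ F ∈ 𝓕, c F * boxInt n σ μ f F.1 F.2
      ≤ mixedNorm n σ p f * mixedNorm n σ p' fun z => ∑ F ∈ 𝓕, c F * boxFn n μ F.1 F.2 z := by
  have hm : ∀ G : DyCube n, Measurable fun x => ∑' k : ℤ,
      f (x, (2:ℝ) ^ (-k)) * boxFn n μ G.1 G.2 (x, (2:ℝ) ^ (-k)) := fun G =>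
    Measurable.tsum fun k => (measurable_slice hf _).mul
      (measurable_slice (measurable_boxFn hμ _ _) _)
  refine le_trans (le_of_eq ?_) (vertPair_le σ hp hf
    (Finset.measurable_fun_sum _ fun F _ => (measurable_boxFn hμ _ _).const_mul _))
  simp only [boxInt_eq_vertPair σ hμ hf, vertPair]
  simp_rw [← lintegral_const_mul _ (hm _)]
  rw [← lintegral_finsetSum _ fun G _ => (hm G).const_mul _]
  refine lintegral_congr fun x => ?_
  simp_rw [← ENNReal.tsum_mul_left]
  rw [← Summable.tsum_finsetSum fun _ _ => ENNReal.summable]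
  refine tsum_congr fun k => ?_
  rw [Finset.mul_sum]
  exact Finset.sum_congr rfl fun F _ => mul_left_comm _ _ _

end FEmbedding

section FStopping

variable {n : ℕ}

/-- The parameter that governs the decay of `boxMass` along the stopping cubes. -/
def decayConst (p : ℝ) : ℝ≥0∞ := 2 ^ (p + 2)

theorem one_le_decayConst {p : ℝ} (hp : 0 < p) : 1 ≤ decayConst p :=
  ENNReal.one_le_rpow (by norm_num) (by linarith)

theorem decayConst_ne_top {p : ℝ} (hp : 0 < p) : decayConst p ≠ ∞ :=
  ENNReal.rpow_ne_top_of_nonneg (by linarith) (by norm_num)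

theorem two_rpow_mul_inv_decayConst (p : ℝ) : 2 ^ p * (2 * (decayConst p)⁻¹) = (2⁻¹ : ℝ≥0∞) := by
  have h2 : (2 : ℝ≥0∞) ≠ 0 := by norm_num
  have h2' : (2 : ℝ≥0∞) ≠ ∞ := by norm_num
  rw [decayConst, ← ENNReal.rpow_neg]
  nth_rewrite 2 [← ENNReal.rpow_one 2]
  rw [← ENNReal.rpow_add _ _ h2 h2', ← ENNReal.rpow_add _ _ h2 h2', ← ENNReal.rpow_neg_one]
  congr 1
  ring

theorem sum_le_two_mul_of_stopping {ι : Type*} [PartialOrder ι] {p : ℝ} (hp : 1 < p)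
    {𝓕 : Finset ι} {A N u : ι → ℝ≥0∞} (hA : ∀ F ∈ 𝓕, A F ≠ ∞) (hN : ∀ F ∈ 𝓕, N F ≠ ∞)
    (h : ∀ F ∈ 𝓕, A F * N F = u F ∨ ∃ P, IsStopPar 𝓕 P F ∧ A F = 2 * A P)
    (hch : ∀ F ∈ 𝓕, ∑ G ∈ stopChildren 𝓕 F, N G ≤ 2 * (decayConst p)⁻¹ * N F) :
    ∑ F ∈ 𝓕, A F ^ p * N F ≤ 2 * ∑ F ∈ 𝓕, A F ^ (p - 1) * u F := by
  have hp0 : 0 < p := by linarith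
  have hS : ∑ F ∈ 𝓕, A F ^ p * N F ≠ ∞ := ENNReal.sum_ne_top.2 fun F hF =>
    ENNReal.mul_ne_top (ENNReal.rpow_ne_top_of_nonneg hp0.le (hA F hF)) (hN F hF)
  have hterm : ∀ F ∈ 𝓕, A F ^ p * N F ≤ A F ^ (p - 1) * u F
      + ∑ P ∈ 𝓕, if F ∈ stopChildren 𝓕 P then 2 ^ p * A P ^ p * N F else 0 := by
    intro F hF
    rcases h F hF with h | ⟨P, hP, hAP⟩
    · refine le_trans (le_of_eq ?_) le_self_add
      rw [← h, ← mul_assoc]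
      congr 1
      conv_lhs => rw [show p = (p - 1) + 1 by ring]
      rw [ENNReal.rpow_add_of_nonneg _ _ (by linarith) zero_le_one, ENNReal.rpow_one]
    · refine le_trans (le_trans (le_of_eq ?_) (Finset.single_le_sum (f := fun P =>
        if F ∈ stopChildren 𝓕 P then 2 ^ p * A P ^ p * N F else 0)
        (fun _ _ => zero_le) hP.1)) le_add_self
      rw [if_pos (mem_stopChildren.2 ⟨hF, hP⟩), hAP, ENNReal.mul_rpow_of_nonneg _ _ hp0.le]
  have hsum : ∑ F ∈ 𝓕, A F ^ p * N F
      ≤ ∑ F ∈ 𝓕, A F ^ (p - 1) * u F + 2⁻¹ * ∑ F ∈ 𝓕, A F ^ p * N F := by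
    refine (Finset.sum_le_sum hterm).trans ?_
    rw [Finset.sum_add_distrib, Finset.sum_comm, Finset.mul_sum]
    refine add_le_add le_rfl (Finset.sum_le_sum fun P hP => ?_)
    calc ∑ F ∈ 𝓕, (if F ∈ stopChildren 𝓕 P then 2 ^ p * A P ^ p * N F else 0)
        = ∑ F ∈ stopChildren 𝓕 P, 2 ^ p * A P ^ p * N F := by
          rw [← Finset.sum_filter]
          refine Finset.sum_congr ?_ fun _ _ => rfl
          ext F
          simp only [Finset.mem_filter, and_iff_right_iff_imp]
          exact fun hF => (mem_stopChildren.1 hF).1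
      _ ≤ 2 ^ p * A P ^ p * (2 * (decayConst p)⁻¹ * N P) := by
          rw [← Finset.mul_sum]
          gcongr
          exact hch P hP
      _ = 2 ^ p * (2 * (decayConst p)⁻¹) * (A P ^ p * N P) := by ring
      _ = _ := by rw [two_rpow_mul_inv_decayConst]
  generalize ∑ F ∈ 𝓕, A F ^ p * N F = S at *
  generalize ∑ F ∈ 𝓕, A F ^ (p - 1) * u F = X at *
  have h2S : 2⁻¹ * S ≠ ∞ := ENNReal.mul_ne_top (by norm_num) hS
  have hSS : S = 2⁻¹ * S + 2⁻¹ * S := by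
    rw [← add_mul, ENNReal.inv_two_add_inv_two, one_mul]
  have h3 : 2⁻¹ * S ≤ X := (ENNReal.add_le_add_iff_right h2S).1 (hSS.symm.trans_le hsum)
  calc S = 2 * (2⁻¹ * S) := by rw [two_mul, ← hSS]
    _ ≤ 2 * X := by gcongr

theorem exists_f_stopping (σ : Measure (Fin n → ℝ)) {p p' : ℝ}
    (hp : p.HolderConjugate p') (hp2 : p' ≤ 2) {μ f : (Fin n → ℝ) × ℝ → ℝ≥0∞}
    (hμ : Measurable μ) (hf : Measurable f) (hfn : mixedNorm n σ p f ≠ ∞)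
    (hN : ∀ Q, boxMass σ p' μ Q ≠ ∞) (𝓐 : Finset (DyCube n)) :
    ∃ (𝓕 : Finset (DyCube n)) (A : DyCube n → ℝ≥0∞), 𝓕 ⊆ 𝓐 ∧
      (∀ Q ∈ 𝓐, ∃ F, IsStopTop 𝓕 F Q ∧ fOk σ p' μ f (decayConst p ^ 2) F (A F) Q) ∧
      (∀ F ∈ 𝓕, boxAvg σ p' μ f F ≤ A F) ∧
      ∑ F ∈ 𝓕, A F ^ p * boxMass σ p' μ F
        ≤ (2 * geomConst (p - 1) * mixedNorm n σ p f) ^ p := by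
  have hD := one_le_decayConst hp.pos
  have hDt := decayConst_ne_top hp.pos
  obtain ⟨𝓕, A, hsub, htop, hle, hAt, halt, hno, hd⟩ := DyCube.isForest.exists_stopping
    (boxAvg σ p' μ f) (fun Q => boxAvg_ne_top σ hp hμ hf hfn (hN Q))
    (fOk σ p' μ f (decayConst p ^ 2)) (fun Q v hv => by
      rw [fOk, ← boxAvg_mul_boxMass σ hp hμ hf (hN Q), mul_assoc]
      calc boxAvg σ p' μ f Q * boxMass σ p' μ Q
          ≤ v * boxInt n σ μ (testFn n p' μ Q.1 Q.2) Q.1 Q.2 :=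
            mul_le_mul' hv (boxMass_le_boxInt_testFn σ hp.symm.pos hμ (hN Q))
        _ ≤ _ := le_mul_of_one_le_left zero_le (one_le_pow₀ hD)) 𝓐
  refine ⟨𝓕, A, hsub, htop, hle, ?_⟩
  have hS : ∑ F ∈ 𝓕, A F ^ p * boxMass σ p' μ F ≠ ∞ := ENNReal.sum_ne_top.2 fun F hF =>
    ENNReal.mul_ne_top (ENNReal.rpow_ne_top_of_nonneg hp.nonneg (hAt F hF)) (hN F)
  refine le_rpow_of_le_mul_rpow hp hS ?_
  calc ∑ F ∈ 𝓕, A F ^ p * boxMass σ p' μ F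
      ≤ 2 * ∑ F ∈ 𝓕, A F ^ (p - 1) * boxInt n σ μ f F.1 F.2 := by
        refine sum_le_two_mul_of_stopping hp.lt hAt (fun F _ => hN F) (fun F hF => ?_)
          fun F hF => ?_
        · refine (halt F hF).imp_left fun h => ?_
          rw [h, boxAvg_mul_boxMass σ hp hμ hf (hN F)]
        · refine sum_boxMass_le_of_not_fOk σ hp hμ hf (hN F) hD hDt (hAt F hF) (hle F hF)
            fun G hG => ?_
          obtain ⟨hG, hP⟩ := mem_stopChildren.1 hG
          exact hno G hG F hP
    _ ≤ 2 * (mixedNorm n σ p f * (geomConst (p - 1)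
          * (∑ F ∈ 𝓕, A F ^ p * boxMass σ p' μ F) ^ (1 / p'))) := by
        refine mul_le_mul' le_rfl ((sum_mul_boxInt_le σ hp hμ hf 𝓕 _).trans ?_)
        exact mul_le_mul' le_rfl (mixedNorm_sum_mul_boxFn_le σ hp hp2 hμ hAt hd)
    _ = _ := by ring

end FStopping

section GStopping

variable {n : ℕ}

theorem setLIntegral_idxCube_le (ω : Measure (Fin n → ℝ)) {p p' : ℝ}
    (hp : p.HolderConjugate p') {g : (Fin n → ℝ) → ℝ≥0∞} (hg : Measurable g) (Q : DyCube n) :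
    ∫⁻ x in idxCube n Q, g x ∂ω ≤ _root_.lpNorm n ω p' g * ω (idxCube n Q) ^ (1 / p) := by
  have h := ENNReal.lintegral_mul_le_Lp_mul_Lq ω hp.symm hg.aemeasurable
    ((measurable_one (α := ℝ≥0∞)).indicator (measurableSet_idxCube Q)).aemeasurable
  have e : ∀ x, (idxCube n Q).indicator (1 : (Fin n → ℝ) → ℝ≥0∞) x ^ p
      = (idxCube n Q).indicator 1 x := fun x => by
    by_cases hx : x ∈ idxCube n Q <;> simp [hx, hp.pos]
  simp only [e, lintegral_indicator_one (measurableSet_idxCube Q)] at h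
  refine le_trans (le_of_eq ?_) h
  rw [← lintegral_indicator (measurableSet_idxCube Q)]
  refine lintegral_congr fun x => ?_
  by_cases hx : x ∈ idxCube n Q <;> simp [hx]

theorem cubeAvg_mul_measure (ω : Measure (Fin n → ℝ)) [IsLocallyFiniteMeasure ω]
    (g : (Fin n → ℝ) → ℝ≥0∞) (Q : DyCube n) :
    cubeAvg n ω g Q.1 Q.2 * ω (idxCube n Q) = ∫⁻ x in idxCube n Q, g x ∂ω := by
  by_cases h0 : ω (idxCube n Q) = 0
  · rw [h0, mul_zero, Measure.restrict_eq_zero.2 h0, lintegral_zero_measure]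
  · exact ENNReal.div_mul_cancel h0 (measure_idxCube_lt_top ω Q).ne

theorem cubeAvg_ne_top (ω : Measure (Fin n → ℝ)) [IsLocallyFiniteMeasure ω] {p p' : ℝ}
    (hp : p.HolderConjugate p') {g : (Fin n → ℝ) → ℝ≥0∞} (hg : Measurable g)
    (hgn : _root_.lpNorm n ω p' g ≠ ∞) (Q : DyCube n) : cubeAvg n ω g Q.1 Q.2 ≠ ∞ := by
  have hle := setLIntegral_idxCube_le ω hp hg Q
  have hp' : 0 < 1 / p := by simpa using hp.pos
  by_cases h0 : ω (idxCube n Q) = 0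
  · rw [h0, ENNReal.zero_rpow_of_pos hp', mul_zero] at hle
    change (∫⁻ x in idxCube n Q, g x ∂ω) / ω (idxCube n Q) ≠ ∞
    rw [le_antisymm hle zero_le, ENNReal.zero_div]
    simp
  · refine ENNReal.div_ne_top (ne_top_of_le_ne_top ?_ hle) h0
    exact ENNReal.mul_ne_top hgn
      (ENNReal.rpow_ne_top_of_nonneg hp'.le (measure_idxCube_lt_top ω Q).ne)

theorem lpNorm_sum_indicator_le (ω : Measure (Fin n → ℝ)) {p p' : ℝ}
    (hp : p.HolderConjugate p') {𝓖 : Finset (DyCube n)} {A : DyCube n → ℝ≥0∞}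
    (hfin : ∀ F ∈ 𝓖, A F ≠ ∞) (hd : ∀ F ∈ 𝓖, ∀ R ∈ 𝓖, F < R → 2 * A R ≤ A F) :
    _root_.lpNorm n ω p (fun x => ∑ G ∈ 𝓖, A G ^ (p' - 1) * (idxCube n G).indicator 1 x)
      ≤ geomConst (p' - 1) * (∑ G ∈ 𝓖, A G ^ p' * ω (idxCube n G)) ^ (1 / p) := by
  have hs : 0 < p' - 1 := hp.symm.sub_one_pos
  have hp0 : 0 < p := hp.pos
  have hexp : (p' - 1) * p = p' := hp.symm.sub_one_mul_conj
  have hm : ∀ G : DyCube n, Measurable ((idxCube n G).indicator (1 : (Fin n → ℝ) → ℝ≥0∞)) :=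
    fun G => measurable_one.indicator (measurableSet_idxCube G)
  have key : ∀ x, (∑ G ∈ 𝓖, A G ^ (p' - 1) * (idxCube n G).indicator 1 x) ^ p
      ≤ geomConst (p' - 1) ^ p * ∑ G ∈ 𝓖, A G ^ p' * (idxCube n G).indicator 1 x := by
    intro x
    have h := rpow_sum_rpow_le_of_doubling hs hp0 A {G ∈ 𝓖 | x ∈ idxCube n G}
      (fun F hF => hfin F (Finset.mem_filter.1 hF).1) fun F hF G hG hne => by
        rw [Finset.mem_filter] at hF hG
        rcases DyCube.lt_or_lt_of_mem hne hF.2 hG.2 with h | h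
        · exact Or.inr (hd F hF.1 G hG.1 h)
        · exact Or.inl (hd G hG.1 F hF.1 h)
    rw [hexp] at h
    have e : ∀ c : DyCube n → ℝ≥0∞, ∑ G ∈ 𝓖, c G * (idxCube n G).indicator 1 x
        = ∑ G ∈ 𝓖 with x ∈ idxCube n G, c G := fun c =>
      (sum_mul_indicator_eq 𝓖 (fun G : DyCube n => idxCube n G) c 1 x).trans (mul_one _)
    rwa [e, e]
  have hint : ∫⁻ x, (∑ G ∈ 𝓖, A G ^ (p' - 1) * (idxCube n G).indicator 1 x) ^ p ∂ω
      ≤ geomConst (p' - 1) ^ p * ∑ G ∈ 𝓖, A G ^ p' * ω (idxCube n G) := by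
    refine (lintegral_mono key).trans (le_of_eq ?_)
    rw [lintegral_const_mul _ (Finset.measurable_fun_sum _ fun G _ => (hm G).const_mul _),
      lintegral_finsetSum _ fun G _ => (hm G).const_mul _]
    congr 2 with G
    rw [lintegral_const_mul _ (hm G), lintegral_indicator_one (measurableSet_idxCube G)]
  calc _ ≤ (geomConst (p' - 1) ^ p * ∑ G ∈ 𝓖, A G ^ p' * ω (idxCube n G)) ^ (1 / p) :=
        ENNReal.rpow_le_rpow hint (by positivity)
    _ = _ := by
        rw [ENNReal.mul_rpow_of_nonneg _ _ (by positivity), ← ENNReal.rpow_mul,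
          mul_one_div_cancel hp0.ne', ENNReal.rpow_one]

theorem sum_mul_setLIntegral_le (ω : Measure (Fin n → ℝ)) {p p' : ℝ}
    (hp : p.HolderConjugate p') {g : (Fin n → ℝ) → ℝ≥0∞} (hg : Measurable g)
    (𝓖 : Finset (DyCube n)) (c : DyCube n → ℝ≥0∞) :
    ∑ G ∈ 𝓖, c G * ∫⁻ x in idxCube n G, g x ∂ω
      ≤ _root_.lpNorm n ω p' g
        * _root_.lpNorm n ω p fun x => ∑ G ∈ 𝓖, c G * (idxCube n G).indicator 1 x := by
  have hm : ∀ G : DyCube n, Measurable fun x =>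
      c G * (idxCube n G).indicator (1 : (Fin n → ℝ) → ℝ≥0∞) x :=
    fun G => (measurable_one.indicator (measurableSet_idxCube G)).const_mul _
  refine le_trans (le_of_eq ?_) (ENNReal.lintegral_mul_le_Lp_mul_Lq ω hp.symm hg.aemeasurable
    (Finset.measurable_fun_sum 𝓖 fun G _ => hm G).aemeasurable)
  simp only [Pi.mul_apply, Finset.mul_sum]
  refine ((lintegral_finsetSum _ fun G _ => hg.mul (hm G)).trans
    (Finset.sum_congr rfl fun G _ => ?_)).symm
  simp only [Pi.mul_apply]
  rw [← lintegral_indicator (measurableSet_idxCube G), ← lintegral_const_mul _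
    (hg.indicator (measurableSet_idxCube G))]
  refine lintegral_congr fun x => ?_
  by_cases hx : x ∈ idxCube n G <;> simp [hx, mul_comm]

theorem exists_g_stopping (ω : Measure (Fin n → ℝ)) [IsLocallyFiniteMeasure ω] {p p' : ℝ}
    (hp : p.HolderConjugate p') {g : (Fin n → ℝ) → ℝ≥0∞} (hg : Measurable g)
    (hgn : _root_.lpNorm n ω p' g ≠ ∞) (𝓐 : Finset (DyCube n)) :
    ∃ 𝓖 : Finset (DyCube n), 𝓖 ⊆ 𝓐 ∧
      (∀ Q ∈ 𝓐, ∃ G, IsStopTop 𝓖 G Q ∧ cubeAvg n ω g Q.1 Q.2 ≤ 2 * cubeAvg n ω g G.1 G.2) ∧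
      ∑ G ∈ 𝓖, cubeAvg n ω g G.1 G.2 ^ p' * ω (idxCube n G)
        ≤ (geomConst (p' - 1) * _root_.lpNorm n ω p' g) ^ p' := by
  set b : DyCube n → ℝ≥0∞ := fun Q => cubeAvg n ω g Q.1 Q.2 with hb
  have hbt : ∀ Q, b Q ≠ ∞ := cubeAvg_ne_top ω hp hg hgn
  obtain ⟨𝓖, A, hsub, htop, hle, hAt, halt, hno, hd⟩ := DyCube.isForest.exists_stopping
    b hbt (fun _ v Q => b Q ≤ 2 * v)
    (fun Q v hv => hv.trans (le_mul_of_one_le_left zero_le one_le_two)) 𝓐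
  have hA : ∀ G ∈ 𝓖, A G = b G := fun G hG => by
    rcases halt G hG with h | ⟨P, hP, h⟩
    · exact h
    · exact le_antisymm (h ▸ (not_le.1 (hno G hG P hP)).le) (hle G hG)
  refine ⟨𝓖, hsub, fun Q hQ => ?_, ?_⟩
  · obtain ⟨G, hG, h⟩ := htop Q hQ
    exact ⟨G, hG, by rwa [hA G hG.1] at h⟩
  have hd' : ∀ F ∈ 𝓖, ∀ R ∈ 𝓖, F < R → 2 * b R ≤ b F := fun F hF R hR h => by
    rw [← hA F hF, ← hA R hR]
    exact hd F hF R hR h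
  change ∑ G ∈ 𝓖, b G ^ p' * ω (idxCube n G) ≤ _
  have hS : ∑ G ∈ 𝓖, b G ^ p' * ω (idxCube n G) ≠ ∞ := ENNReal.sum_ne_top.2 fun F _ =>
    ENNReal.mul_ne_top (ENNReal.rpow_ne_top_of_nonneg hp.symm.nonneg (hbt F))
      (measure_idxCube_lt_top ω F).ne
  refine le_rpow_of_le_mul_rpow hp.symm hS ?_
  calc ∑ G ∈ 𝓖, b G ^ p' * ω (idxCube n G)
      = ∑ G ∈ 𝓖, b G ^ (p' - 1) * ∫⁻ x in idxCube n G, g x ∂ω := by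
        refine Finset.sum_congr rfl fun G _ => ?_
        rw [← cubeAvg_mul_measure, ← mul_assoc]
        congr 1
        conv_lhs => rw [show p' = (p' - 1) + 1 by ring]
        rw [ENNReal.rpow_add_of_nonneg _ _ hp.symm.sub_one_pos.le zero_le_one, ENNReal.rpow_one]
    _ ≤ _root_.lpNorm n ω p' g * (geomConst (p' - 1)
          * (∑ G ∈ 𝓖, b G ^ p' * ω (idxCube n G)) ^ (1 / p)) :=
        (sum_mul_setLIntegral_le ω hp hg 𝓖 _).trans
          (mul_le_mul' le_rfl (lpNorm_sum_indicator_le ω hp (fun G _ => hbt G) hd'))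
    _ = _ := by ring

end GStopping

section Localization

variable {n : ℕ} {ι α : Type*} [PartialOrder ι]

theorem sum_le_sum_isStopTop {𝓐 𝓕 : Finset ι} (h : ∀ Q ∈ 𝓐, ∃ F, IsStopTop 𝓕 F Q)
    (y : ι → ℝ≥0∞) :
    ∑ Q ∈ 𝓐, y Q ≤ ∑ F ∈ 𝓕, ∑ Q ∈ 𝓐 with IsStopTop 𝓕 F Q, y Q := by
  simp only [Finset.sum_filter]
  rw [Finset.sum_comm]
  refine Finset.sum_le_sum fun Q hQ => ?_
  obtain ⟨F, hF⟩ := h Q hQ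
  refine le_trans (le_of_eq ?_) (Finset.single_le_sum
    (f := fun F => if IsStopTop 𝓕 F Q then y Q else 0) (fun _ _ => zero_le) hF.1)
  rw [if_pos hF]

/-- The part of `s F` outside the sets of the children of `F`. -/
def stopRest (s : ι → Set α) (𝓕 : Finset ι) (F : ι) : Set α :=
  s F \ ⋃ G ∈ stopChildren 𝓕 F, s G

theorem measurableSet_stopRest [MeasurableSpace α] {s : ι → Set α}
    (hs : ∀ F, MeasurableSet (s F)) (𝓕 : Finset ι) (F : ι) :
    MeasurableSet (stopRest s 𝓕 F) :=
  (hs F).diff (Finset.measurableSet_biUnion _ fun G _ => hs G)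

theorem eq_of_mem_stopRest (hι : IsForest ι) {s : ι → Set α} (hs : Monotone s)
    (hcomp : ∀ F G z, z ∈ s F → z ∈ s G → F ≤ G ∨ G ≤ F) {𝓕 : Finset ι} {F G : ι}
    (hF : F ∈ 𝓕) (hG : G ∈ 𝓕) {z : α} (hzF : z ∈ stopRest s 𝓕 F) (hzG : z ∈ stopRest s 𝓕 G) :
    F = G := by
  have aux : ∀ F ∈ 𝓕, ∀ G ∈ 𝓕, z ∈ stopRest s 𝓕 F → z ∈ s G → ¬ G < F := by
    intro F hF G hG hz hzG hlt
    obtain ⟨H, hH, hGH⟩ := hι.exists_stopChild hF hG hlt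
    exact hz.2 (mem_biUnion hH (hs hGH hzG))
  by_contra hne
  rcases hcomp F G z hzF.1 hzG.1 with h | h
  · exact aux G hG F hF hzG hzF.1 (lt_of_le_of_ne h hne)
  · exact aux F hF G hG hzF hzG.1 (lt_of_le_of_ne h (Ne.symm hne))

theorem le_indicator_stopRest_add (s : ι → Set α) (𝓕 : Finset ι) (F : ι) (g : α → ℝ≥0∞)
    {z : α} (hz : z ∈ s F) :
    g z ≤ (stopRest s 𝓕 F).indicator g z + ∑ G ∈ stopChildren 𝓕 F, (s G).indicator g z := by
  by_cases h : z ∈ stopRest s 𝓕 F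
  · rw [indicator_of_mem h]
    exact le_self_add
  · have : ∃ G ∈ stopChildren 𝓕 F, z ∈ s G := by
      by_contra hc
      push Not at hc
      exact h ⟨hz, by simpa using hc⟩
    obtain ⟨G, hG, hzG⟩ := this
    refine le_trans ?_ le_add_self
    refine le_trans ?_ (Finset.single_le_sum (f := fun G => (s G).indicator g z)
      (fun _ _ => zero_le) hG)
    rw [indicator_of_mem hzG]

theorem IsStopTop.le_of_comparable {𝓕 : Finset ι} {F G Q : ι} (hQ : IsStopTop 𝓕 F Q)
    (hG : G ∈ stopChildren 𝓕 F) (h : Q ≤ G ∨ G ≤ Q) : G ≤ Q := by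
  rw [mem_stopChildren] at hG
  exact h.resolve_left fun hc => (hQ.2.2 G hG.1 hc).not_gt hG.2.2.1

theorem rpow_sum_le_of_eq_of_ne_zero {κ : Type*} {T : Finset κ} {x : κ → ℝ≥0∞} {r : ℝ} (hr : 0 < r)
    (h : ∀ G ∈ T, ∀ H ∈ T, x G ≠ 0 → x H ≠ 0 → G = H) :
    (∑ G ∈ T, x G) ^ r ≤ ∑ G ∈ T, x G ^ r := by
  rw [← ENNReal.le_rpow_inv_iff hr]
  refine sum_le_of_eq_of_ne_zero (fun G hG => ?_) h
  rw [ENNReal.le_rpow_inv_iff hr]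
  exact Finset.single_le_sum (f := fun G => x G ^ r) (fun _ _ => zero_le) hG

end Localization

section OneSidedF

variable {n : ℕ}

theorem sum_le_lambdaLoc (σ ω : Measure (Fin n → ℝ)) (μ : (Fin n → ℝ) × ℝ → ℝ≥0∞)
    (lam : CubeIdx n → ℝ≥0) {T : Finset (DyCube n)} {F : DyCube n} (hT : ∀ Q ∈ T, Q ≤ F)
    (f : (Fin n → ℝ) × ℝ → ℝ≥0∞) (g : (Fin n → ℝ) → ℝ≥0∞) :
    ∑ Q ∈ T, (lam Q : ℝ≥0∞) * boxInt n σ μ f Q.1 Q.2 * ∫⁻ x in idxCube n Q, g x ∂ω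
      ≤ lambdaLoc n σ ω μ lam F f g := by
  refine le_trans (Finset.sum_le_sum fun Q hQ => ?_) (ENNReal.sum_le_tsum (T : Finset (CubeIdx n)))
  exact (if_pos (hT Q hQ).2).ge

/-- The function `∑ b_G 1_G` over the children `G` of `F`. -/
def childAvg (ω : Measure (Fin n → ℝ)) (g : (Fin n → ℝ) → ℝ≥0∞) (𝓕 : Finset (DyCube n))
    (F : DyCube n) (x : Fin n → ℝ) : ℝ≥0∞ :=
  ∑ G ∈ stopChildren 𝓕 F, (idxCube n G).indicator (fun _ => cubeAvg n ω g G.1 G.2) x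

theorem measurable_childAvg (ω : Measure (Fin n → ℝ)) (g : (Fin n → ℝ) → ℝ≥0∞)
    (𝓕 : Finset (DyCube n)) (F : DyCube n) : Measurable (childAvg ω g 𝓕 F) :=
  Finset.measurable_fun_sum _ fun G _ => measurable_const.indicator (measurableSet_idxCube G)

theorem setLIntegral_le_stopRest_add (ω : Measure (Fin n → ℝ)) [IsLocallyFiniteMeasure ω]
    {g : (Fin n → ℝ) → ℝ≥0∞} (hg : Measurable g) {𝓕 : Finset (DyCube n)} {F Q : DyCube n}
    (hQ : IsStopTop 𝓕 F Q) :
    ∫⁻ x in idxCube n Q, g x ∂ω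
      ≤ ∫⁻ x in idxCube n Q, (stopRest (fun G : DyCube n => idxCube n G) 𝓕 F).indicator g x ∂ω
        + ∫⁻ x in idxCube n Q, childAvg ω g 𝓕 F x ∂ω := by
  have hm : Measurable ((stopRest (fun G : DyCube n => idxCube n G) 𝓕 F).indicator g) :=
    hg.indicator (measurableSet_stopRest (fun G : DyCube n => measurableSet_idxCube G) 𝓕 F)
  have h1 : ∫⁻ x in idxCube n Q, g x ∂ω
      ≤ ∫⁻ x in idxCube n Q, ((stopRest (fun G : DyCube n => idxCube n G) 𝓕 F).indicator g x
        + ∑ G ∈ stopChildren 𝓕 F, (idxCube n G).indicator g x) ∂ω :=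
    setLIntegral_mono' (measurableSet_idxCube Q) fun x hx =>
      le_indicator_stopRest_add (fun G : DyCube n => idxCube n G) 𝓕 F g (hQ.2.1.2 hx)
  refine h1.trans ?_
  rw [lintegral_add_left hm]
  refine add_le_add le_rfl ?_
  unfold childAvg
  rw [lintegral_finsetSum _ fun (G : DyCube n) _ => hg.indicator (measurableSet_idxCube G),
    lintegral_finsetSum _ fun (G : DyCube n) _ =>
      measurable_const.indicator (measurableSet_idxCube G)]
  refine Finset.sum_le_sum fun G hG => ?_
  rw [lintegral_indicator (measurableSet_idxCube G), lintegral_indicator (measurableSet_idxCube G),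
    Measure.restrict_restrict (measurableSet_idxCube G), lintegral_const,
    Measure.restrict_apply_univ]
  rcases (idxCube n G ∩ idxCube n Q).eq_empty_or_nonempty with he | ⟨x, hxG, hxQ⟩
  · simp [he]
  · have hGQ := hQ.le_of_comparable hG (DyCube.le_or_le_of_mem hxQ hxG)
    rw [inter_eq_left.2 hGQ.2, cubeAvg_mul_measure]

theorem lintegral_childAvg_rpow_le (ω : Measure (Fin n → ℝ)) {q : ℝ} (hq : 0 < q)
    (g : (Fin n → ℝ) → ℝ≥0∞) (𝓕 : Finset (DyCube n)) (F : DyCube n) :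
    ∫⁻ x, childAvg ω g 𝓕 F x ^ q ∂ω
      ≤ ∑ G ∈ stopChildren 𝓕 F, cubeAvg n ω g G.1 G.2 ^ q * ω (idxCube n G) := by
  have h : ∀ x, childAvg ω g 𝓕 F x ^ q ≤ ∑ G ∈ stopChildren 𝓕 F,
      (idxCube n G).indicator (fun _ => cubeAvg n ω g G.1 G.2 ^ q) x := fun x => by
    refine (rpow_sum_le_of_eq_of_ne_zero hq fun G hG H hH h1 h2 =>
      eq_of_mem_stopChildren_of_mem hG hH (mem_of_indicator_ne_zero h1)
        (mem_of_indicator_ne_zero h2)).trans (le_of_eq ?_)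
    refine Finset.sum_congr rfl fun G _ => ?_
    by_cases hx : x ∈ idxCube n G <;> simp [hx, hq]
  refine (lintegral_mono h).trans (le_of_eq ?_)
  rw [lintegral_finsetSum _ fun (G : DyCube n) _ =>
      measurable_const.indicator (measurableSet_idxCube G)]
  refine Finset.sum_congr rfl fun G _ => ?_
  rw [lintegral_indicator_const (measurableSet_idxCube G)]

theorem sum_lintegral_stopRest_le (ω : Measure (Fin n → ℝ)) {q : ℝ} (hq : 0 < q)
    {g : (Fin n → ℝ) → ℝ≥0∞} (hg : Measurable g) (𝓕 : Finset (DyCube n)) :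
    ∑ F ∈ 𝓕, ∫⁻ x, (stopRest (fun G : DyCube n => idxCube n G) 𝓕 F).indicator g x ^ q ∂ω
      ≤ ∫⁻ x, g x ^ q ∂ω := by
  have hm : ∀ F, Measurable fun x =>
      (stopRest (fun G : DyCube n => idxCube n G) 𝓕 F).indicator g x ^ q := fun F =>
    (hg.indicator (measurableSet_stopRest (fun G : DyCube n =>
      measurableSet_idxCube G) 𝓕 F)).pow_const _
  rw [← lintegral_finsetSum _ fun F _ => hm F]
  refine lintegral_mono fun x => ?_
  refine sum_le_of_eq_of_ne_zero (fun F _ => ?_) fun F hF G hG h1 h2 => ?_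
  · exact ENNReal.rpow_le_rpow (indicator_le_self _ _ _) hq.le
  · refine eq_of_mem_stopRest DyCube.isForest (s := fun G : DyCube n => idxCube n G)
      (fun _ _ h => h.2) (fun _ _ _ => DyCube.le_or_le_of_mem) hF hG (z := x) ?_ ?_
    · by_contra h
      exact h1 (by rw [indicator_of_notMem h, ENNReal.zero_rpow_of_pos hq])
    · by_contra h
      exact h2 (by rw [indicator_of_notMem h, ENNReal.zero_rpow_of_pos hq])

theorem sum_isStopTop_le_of_testing (σ ω : Measure (Fin n → ℝ)) [IsLocallyFiniteMeasure ω]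
    {p p' : ℝ} (hp : p.HolderConjugate p') {μ f : (Fin n → ℝ) × ℝ → ℝ≥0∞}
    {g : (Fin n → ℝ) → ℝ≥0∞} (hg : Measurable g) (lam : CubeIdx n → ℝ≥0) {t : ℝ≥0∞}
    (ht : ∀ (Q : CubeIdx n) (g : (Fin n → ℝ) → ℝ≥0∞), Measurable g →
      lambdaLoc n σ ω μ lam Q (testFn n p' μ Q.1 Q.2) g
        ≤ t * mixedNorm n σ p (testFn n p' μ Q.1 Q.2) * _root_.lpNorm n ω p' g)
    {𝓕 T : Finset (DyCube n)} {F : DyCube n} {K v : ℝ≥0∞}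
    (hT : ∀ Q ∈ T, IsStopTop 𝓕 F Q ∧ fOk σ p' μ f K F v Q) :
    ∑ Q ∈ T, (lam Q : ℝ≥0∞) * boxInt n σ μ f Q.1 Q.2 * ∫⁻ x in idxCube n Q, g x ∂ω
      ≤ K * t * (v * boxMass σ p' μ F ^ (1 / p)
        * ((∫⁻ x, (stopRest (fun G : DyCube n => idxCube n G) 𝓕 F).indicator g x ^ p' ∂ω)
            ^ (1 / p')
          + (∑ G ∈ stopChildren 𝓕 F, cubeAvg n ω g G.1 G.2 ^ p' * ω (idxCube n G))
            ^ (1 / p'))) := by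
  set φ := testFn n p' μ F.1 F.2
  set E := stopRest (fun G : DyCube n => idxCube n G) 𝓕 F
  have hE : Measurable (E.indicator g) :=
    hg.indicator (measurableSet_stopRest (fun G : DyCube n => measurableSet_idxCube G) 𝓕 F)
  have hle : ∀ Q ∈ T, Q ≤ F := fun Q hQ => (hT Q hQ).1.2.1
  have h0 : 0 ≤ 1 / p' := by simpa using hp.symm.nonneg
  have htest : ∀ h : (Fin n → ℝ) → ℝ≥0∞, Measurable h → ∀ y, ∫⁻ x, h x ^ p' ∂ω ≤ y →
      ∑ Q ∈ T, (lam Q : ℝ≥0∞) * boxInt n σ μ φ Q.1 Q.2 * ∫⁻ x in idxCube n Q, h x ∂ω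
        ≤ t * boxMass σ p' μ F ^ (1 / p) * y ^ (1 / p') := fun h hh y hy => by
    refine ((sum_le_lambdaLoc σ ω μ lam hle φ h).trans (ht F h hh)).trans ?_
    exact mul_le_mul' (mul_le_mul' le_rfl (mixedNorm_testFn_le σ hp μ F))
      (ENNReal.rpow_le_rpow hy h0)
  calc ∑ Q ∈ T, (lam Q : ℝ≥0∞) * boxInt n σ μ f Q.1 Q.2 * ∫⁻ x in idxCube n Q, g x ∂ω
      ≤ ∑ Q ∈ T, (lam Q : ℝ≥0∞) * (K * v * boxInt n σ μ φ Q.1 Q.2)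
          * (∫⁻ x in idxCube n Q, E.indicator g x ∂ω
            + ∫⁻ x in idxCube n Q, childAvg ω g 𝓕 F x ∂ω) :=
        Finset.sum_le_sum fun Q hQ => mul_le_mul' (mul_le_mul' le_rfl (hT Q hQ).2)
          (setLIntegral_le_stopRest_add ω hg (hT Q hQ).1)
    _ = K * v * (∑ Q ∈ T, (lam Q : ℝ≥0∞) * boxInt n σ μ φ Q.1 Q.2
            * ∫⁻ x in idxCube n Q, E.indicator g x ∂ω
          + ∑ Q ∈ T, (lam Q : ℝ≥0∞) * boxInt n σ μ φ Q.1 Q.2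
            * ∫⁻ x in idxCube n Q, childAvg ω g 𝓕 F x ∂ω) := by
        rw [← Finset.sum_add_distrib, Finset.mul_sum]
        refine Finset.sum_congr rfl fun Q _ => ?_
        ring
    _ ≤ K * v * (t * boxMass σ p' μ F ^ (1 / p) * (∫⁻ x, E.indicator g x ^ p' ∂ω) ^ (1 / p')
          + t * boxMass σ p' μ F ^ (1 / p) * (∑ G ∈ stopChildren 𝓕 F,
            cubeAvg n ω g G.1 G.2 ^ p' * ω (idxCube n G)) ^ (1 / p')) :=
        mul_le_mul' le_rfl (add_le_add (htest _ hE _ le_rfl)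
          (htest _ (measurable_childAvg ω g 𝓕 F) _
            (lintegral_childAvg_rpow_le ω hp.symm.pos g 𝓕 F)))
    _ = _ := by ring

/-- The estimate for the cubes where the average of `f` dominates. -/
theorem sum_le_of_testing (σ ω : Measure (Fin n → ℝ)) [IsLocallyFiniteMeasure ω]
    {p p' : ℝ} (hp : p.HolderConjugate p') (hp2 : p' ≤ 2) {μ f : (Fin n → ℝ) × ℝ → ℝ≥0∞}
    {g : (Fin n → ℝ) → ℝ≥0∞} (hμ : Measurable μ) (hf : Measurable f) (hg : Measurable g)
    (hfn : mixedNorm n σ p f ≤ 1) (hgn : _root_.lpNorm n ω p' g ≤ 1)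
    (hN : ∀ Q, boxMass σ p' μ Q ≠ ∞) (lam : CubeIdx n → ℝ≥0) {t : ℝ≥0∞}
    (ht : ∀ (Q : CubeIdx n) (g : (Fin n → ℝ) → ℝ≥0∞), Measurable g →
      lambdaLoc n σ ω μ lam Q (testFn n p' μ Q.1 Q.2) g
        ≤ t * mixedNorm n σ p (testFn n p' μ Q.1 Q.2) * _root_.lpNorm n ω p' g)
    {𝓐 : Finset (DyCube n)}
    (h𝓐 : ∀ Q ∈ 𝓐, cubeAvg n ω g Q.1 Q.2 ^ p' * ω (idxCube n Q)
      ≤ boxAvg σ p' μ f Q ^ p * boxMass σ p' μ Q) :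
    ∑ Q ∈ 𝓐, (lam Q : ℝ≥0∞) * boxInt n σ μ f Q.1 Q.2 * ∫⁻ x in idxCube n Q, g x ∂ω
      ≤ decayConst p ^ 2 * t * (2 * geomConst (p - 1) + (2 * geomConst (p - 1)) ^ p) := by
  obtain ⟨𝓕, A, hsub, htop, hle, hS⟩ := exists_f_stopping σ hp hp2 hμ hf
    (ne_top_of_le_ne_top ENNReal.one_ne_top hfn) hN 𝓐
  set S := ∑ F ∈ 𝓕, A F ^ p * boxMass σ p' μ F
  have hS' : S ≤ (2 * geomConst (p - 1)) ^ p :=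
    hS.trans (ENNReal.rpow_le_rpow (mul_le_of_le_one_right zero_le hfn) hp.nonneg)
  have hx : ∑ F ∈ 𝓕, ∫⁻ x, (stopRest (fun G : DyCube n => idxCube n G) 𝓕 F).indicator g x ^ p' ∂ω
      ≤ 1 := by
    refine (sum_lintegral_stopRest_le ω hp.symm.pos hg 𝓕).trans ?_
    rw [← lpNorm_rpow ω hp.symm.pos]
    exact ENNReal.rpow_le_one hgn hp.symm.nonneg
  have hy : ∑ F ∈ 𝓕, ∑ G ∈ stopChildren 𝓕 F, cubeAvg n ω g G.1 G.2 ^ p' * ω (idxCube n G)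
      ≤ S := by
    refine (IsForest.sum_stopChildren_le fun G : DyCube n =>
      cubeAvg n ω g G.1 G.2 ^ p' * ω (idxCube n G)).trans ?_
    refine Finset.sum_le_sum fun F hF => (h𝓐 F (hsub hF)).trans ?_
    exact mul_le_mul' (ENNReal.rpow_le_rpow (hle F hF) hp.nonneg) le_rfl
  refine (sum_le_sum_isStopTop (fun Q hQ => (htop Q hQ).imp fun _ h => h.1) _).trans ?_
  calc _ ≤ ∑ F ∈ 𝓕, decayConst p ^ 2 * t * (A F * boxMass σ p' μ F ^ (1 / p)
        * ((∫⁻ x, (stopRest (fun G : DyCube n => idxCube n G) 𝓕 F).indicator g x ^ p' ∂ω)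
            ^ (1 / p')
          + (∑ G ∈ stopChildren 𝓕 F, cubeAvg n ω g G.1 G.2 ^ p' * ω (idxCube n G))
            ^ (1 / p'))) := by
        refine Finset.sum_le_sum fun F _ =>
          sum_isStopTop_le_of_testing σ ω hp hg lam ht fun Q hQ => ?_
        obtain ⟨hQ, hQF⟩ := Finset.mem_filter.1 hQ
        obtain ⟨G, hG, hok⟩ := htop Q hQ
        exact ⟨hQF, hQF.unique hG ▸ hok⟩
    _ ≤ decayConst p ^ 2 * t * (S ^ (1 / p) + S) := by
        rw [← Finset.mul_sum]
        exact mul_le_mul' le_rfl (sum_stopping_le hp 𝓕 A _ _ _ hx hy)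
    _ ≤ _ := by
        refine mul_le_mul' le_rfl (add_le_add ?_ hS')
        rw [one_div, ENNReal.rpow_inv_le_iff hp.pos]
        exact hS'

end OneSidedF

section OneSidedG

variable {n : ℕ}

theorem measurable_vertPair_integrand {f h : (Fin n → ℝ) × ℝ → ℝ≥0∞} (hf : Measurable f)
    (hh : Measurable h) :
    Measurable fun x => ∑' k : ℤ, f (x, (2:ℝ) ^ (-k)) * h (x, (2:ℝ) ^ (-k)) :=
  Measurable.tsum fun _ => (measurable_slice hf _).mul (measurable_slice hh _)

theorem vertPair_mono (σ : Measure (Fin n → ℝ)) {f f' h h' : (Fin n → ℝ) × ℝ → ℝ≥0∞}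
    (H : ∀ z, f z * h z ≤ f' z * h' z) : vertPair σ f h ≤ vertPair σ f' h' :=
  lintegral_mono fun _ => ENNReal.tsum_le_tsum fun _ => H _

theorem boxInt_add (σ : Measure (Fin n → ℝ)) {μ f f' : (Fin n → ℝ) × ℝ → ℝ≥0∞}
    (hμ : Measurable μ) (hf : Measurable f) (hf' : Measurable f') (Q : DyCube n) :
    boxInt n σ μ (fun z => f z + f' z) Q.1 Q.2
      = boxInt n σ μ f Q.1 Q.2 + boxInt n σ μ f' Q.1 Q.2 := by
  rw [boxInt_eq_vertPair σ hμ hf, boxInt_eq_vertPair σ hμ hf',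
    boxInt_eq_vertPair σ hμ (f := fun z => f z + f' z) (hf.add hf')]
  unfold vertPair
  rw [← lintegral_add_left (measurable_vertPair_integrand hf (measurable_boxFn hμ _ _))]
  refine lintegral_congr fun x => ?_
  rw [← ENNReal.tsum_add]
  exact tsum_congr fun k => add_mul _ _ _

theorem boxInt_finsetSum (σ : Measure (Fin n → ℝ)) {ι : Type*}
    {μ : (Fin n → ℝ) × ℝ → ℝ≥0∞} {f : ι → (Fin n → ℝ) × ℝ → ℝ≥0∞}
    (hμ : Measurable μ) (hf : ∀ i, Measurable (f i)) (T : Finset ι) (Q : DyCube n) :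
    boxInt n σ μ (fun z => ∑ i ∈ T, f i z) Q.1 Q.2 = ∑ i ∈ T, boxInt n σ μ (f i) Q.1 Q.2 := by
  simp only [fun i => boxInt_eq_vertPair σ hμ (hf i),
    boxInt_eq_vertPair σ hμ (Finset.measurable_fun_sum T fun i _ => hf i)]
  unfold vertPair
  rw [← lintegral_finsetSum _ fun i _ =>
    measurable_vertPair_integrand (hf i) (measurable_boxFn hμ _ _)]
  refine lintegral_congr fun x => ?_
  rw [← Summable.tsum_finsetSum fun _ _ => ENNReal.summable]
  exact tsum_congr fun k => Finset.sum_mul _ _ _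

theorem boxInt_const_mul (σ : Measure (Fin n → ℝ)) {μ f : (Fin n → ℝ) × ℝ → ℝ≥0∞}
    (hμ : Measurable μ) (hf : Measurable f) (c : ℝ≥0∞) (Q : DyCube n) :
    boxInt n σ μ (fun z => c * f z) Q.1 Q.2 = c * boxInt n σ μ f Q.1 Q.2 := by
  rw [boxInt_eq_vertPair σ hμ hf, boxInt_eq_vertPair σ hμ (hf.const_mul c)]
  unfold vertPair
  rw [← lintegral_const_mul _ (measurable_vertPair_integrand hf (measurable_boxFn hμ _ _))]
  refine lintegral_congr fun x => ?_
  rw [← ENNReal.tsum_mul_left]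
  exact tsum_congr fun k => mul_assoc _ _ _

/-- The function `∑ a_H φ_H` over the children `H` of `G`. -/
def childTest (σ : Measure (Fin n → ℝ)) (p' : ℝ) (μ f : (Fin n → ℝ) × ℝ → ℝ≥0∞)
    (𝓖 : Finset (DyCube n)) (G : DyCube n) (z : (Fin n → ℝ) × ℝ) : ℝ≥0∞ :=
  ∑ H ∈ stopChildren 𝓖 G, boxAvg σ p' μ f H * testFn n p' μ H.1 H.2 z

theorem measurable_childTest (σ : Measure (Fin n → ℝ)) (p' : ℝ)
    {μ : (Fin n → ℝ) × ℝ → ℝ≥0∞} (hμ : Measurable μ) (f : (Fin n → ℝ) × ℝ → ℝ≥0∞)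
    (𝓖 : Finset (DyCube n)) (G : DyCube n) : Measurable (childTest σ p' μ f 𝓖 G) :=
  Finset.measurable_fun_sum _ fun H _ => (measurable_testFn p' hμ H).const_mul _

theorem boxInt_indicator_cbox_le (σ : Measure (Fin n → ℝ)) {p p' : ℝ}
    (hp : p.HolderConjugate p') {μ f : (Fin n → ℝ) × ℝ → ℝ≥0∞} (hμ : Measurable μ)
    (hf : Measurable f) {Q H : DyCube n} (hN : boxMass σ p' μ H ≠ ∞) (hHQ : H ≤ Q) :
    boxInt n σ μ ((cbox H).indicator f) Q.1 Q.2
      ≤ boxAvg σ p' μ f H * boxInt n σ μ (testFn n p' μ H.1 H.2) Q.1 Q.2 := by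
  have h1 : boxInt n σ μ ((cbox H).indicator f) Q.1 Q.2 ≤ boxInt n σ μ f H.1 H.2 := by
    rw [boxInt_eq_vertPair σ hμ (hf.indicator (measurableSet_cbox H)), boxInt_eq_vertPair σ hμ hf]
    refine vertPair_mono σ fun z => ?_
    by_cases hz : z ∈ cbox H
    · refine mul_le_mul' (indicator_le_self _ _ _) (le_of_eq ?_)
      rw [boxFn, boxFn, indicator_of_mem (by exact cbox_mono hHQ hz),
        indicator_of_mem (by exact hz)]
    · simp [hz]
  refine h1.trans ?_
  rw [← boxAvg_mul_boxMass σ hp hμ hf hN]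
  refine mul_le_mul' le_rfl ((boxMass_le_boxInt_testFn σ hp.symm.pos hμ hN).trans ?_)
  have hφ := measurable_testFn p' hμ H
  rw [boxInt_eq_vertPair σ hμ hφ, boxInt_eq_vertPair σ hμ hφ]
  exact vertPair_mono σ fun z => mul_le_mul' le_rfl (boxFn_mono μ hHQ z)

theorem boxInt_le_stopRest_add (σ : Measure (Fin n → ℝ)) {p p' : ℝ}
    (hp : p.HolderConjugate p') {μ f : (Fin n → ℝ) × ℝ → ℝ≥0∞} (hμ : Measurable μ)
    (hf : Measurable f) (hN : ∀ Q, boxMass σ p' μ Q ≠ ∞) {𝓖 : Finset (DyCube n)}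
    {G Q : DyCube n} (hQ : IsStopTop 𝓖 G Q) :
    boxInt n σ μ f Q.1 Q.2 ≤ boxInt n σ μ ((stopRest cbox 𝓖 G).indicator f) Q.1 Q.2
      + boxInt n σ μ (childTest σ p' μ f 𝓖 G) Q.1 Q.2 := by
  have hE : Measurable ((stopRest cbox 𝓖 G).indicator f) :=
    hf.indicator (measurableSet_stopRest measurableSet_cbox 𝓖 G)
  have hC : ∀ H : DyCube n, Measurable ((cbox H).indicator f) := fun H =>
    hf.indicator (measurableSet_cbox H)
  have hCs : Measurable fun z => ∑ H ∈ stopChildren 𝓖 G, (cbox H).indicator f z :=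
    Finset.measurable_fun_sum _ fun H _ => hC H
  have h1 : boxInt n σ μ f Q.1 Q.2 ≤ boxInt n σ μ (fun z => (stopRest cbox 𝓖 G).indicator f z
      + ∑ H ∈ stopChildren 𝓖 G, (cbox H).indicator f z) Q.1 Q.2 := by
    rw [boxInt_eq_vertPair σ hμ hf]
    refine le_trans ?_ (boxInt_eq_vertPair σ hμ (hE.add hCs) Q.1 Q.2).ge
    refine vertPair_mono σ fun z => ?_
    by_cases hz : z ∈ cbox Q
    · exact mul_le_mul' (le_indicator_stopRest_add cbox 𝓖 G f (cbox_mono hQ.2.1 hz)) le_rfl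
    · rw [boxFn, indicator_of_notMem (by exact hz), mul_zero]
      exact zero_le
  refine h1.trans ?_
  unfold childTest
  rw [boxInt_add σ hμ hE hCs, boxInt_finsetSum σ hμ hC,
    boxInt_finsetSum σ hμ fun H => (measurable_testFn p' hμ H).const_mul _]
  refine add_le_add le_rfl (Finset.sum_le_sum fun H hH => ?_)
  rw [boxInt_const_mul σ hμ (measurable_testFn p' hμ H)]
  by_cases hc : Q ≤ H ∨ H ≤ Q
  · exact boxInt_indicator_cbox_le σ hp hμ hf (hN H) (hQ.le_of_comparable hH hc)
  · refine le_trans (le_of_eq ?_) zero_le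
    rw [boxInt_eq_vertPair σ hμ (hC H), vertPair]
    refine (lintegral_congr fun x => ENNReal.tsum_eq_zero.2 fun k => ?_).trans lintegral_zero
    by_contra h0
    obtain ⟨h1, h2⟩ := mul_ne_zero_iff.1 h0
    exact hc (DyCube.le_or_le_of_mem (mem_cbox_of_boxFn_ne_zero h2).1
      (mem_of_indicator_ne_zero h1).1)

theorem mem_idxCube_of_vertL2_testFn_ne_zero {p' : ℝ} (hp : 1 < p')
    {μ : (Fin n → ℝ) × ℝ → ℝ≥0∞} {Q : DyCube n} {x : Fin n → ℝ}
    (h : vertL2 n (testFn n p' μ Q.1 Q.2) x ≠ 0) : x ∈ idxCube n Q := by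
  refine mem_idxCube_of_vertL2_ne_zero (μ := μ) fun h0 => h ?_
  have := vertL2_testFn_le hp μ Q x
  rw [h0, ENNReal.zero_rpow_of_pos (by linarith)] at this
  exact le_antisymm this zero_le

theorem mem_idxCube_of_testFn_ne_zero {p' : ℝ} {μ : (Fin n → ℝ) × ℝ → ℝ≥0∞} {Q : DyCube n}
    {z : (Fin n → ℝ) × ℝ} (h : testFn n p' μ Q.1 Q.2 z ≠ 0) : z.1 ∈ idxCube n Q := by
  rw [testFn_eq] at h
  exact (mem_cbox_of_boxFn_ne_zero (mul_ne_zero_iff.1 h).2).1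

theorem lintegral_vertL2_childTest_le (σ : Measure (Fin n → ℝ)) {p p' : ℝ}
    (hp : p.HolderConjugate p') {μ : (Fin n → ℝ) × ℝ → ℝ≥0∞} (hμ : Measurable μ)
    (f : (Fin n → ℝ) × ℝ → ℝ≥0∞) (𝓖 : Finset (DyCube n)) (G : DyCube n) :
    ∫⁻ x, vertL2 n (childTest σ p' μ f 𝓖 G) x ^ p ∂σ
      ≤ ∑ H ∈ stopChildren 𝓖 G, boxAvg σ p' μ f H ^ p * boxMass σ p' μ H := by
  set a := boxAvg σ p' μ f
  have hp0 := hp.pos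
  have hM : ∀ H : DyCube n, Measurable fun x => vertL2 n (testFn n p' μ H.1 H.2) x ^ p := fun H =>
    (measurable_vertL2 (measurable_testFn p' hμ H)).pow_const _
  have key : ∀ x, vertL2 n (childTest σ p' μ f 𝓖 G) x ^ p
      ≤ ∑ H ∈ stopChildren 𝓖 G, a H ^ p * vertL2 n (testFn n p' μ H.1 H.2) x ^ p := by
    intro x
    have h1 : ∀ k : ℤ, childTest σ p' μ f 𝓖 G (x, (2:ℝ) ^ (-k)) ^ 2 ≤ ∑ H ∈ stopChildren 𝓖 G,
        a H ^ 2 * testFn n p' μ H.1 H.2 (x, (2:ℝ) ^ (-k)) ^ 2 := fun k => by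
      have := rpow_sum_le_of_eq_of_ne_zero (T := stopChildren 𝓖 G)
        (x := fun H => a H * testFn n p' μ H.1 H.2 (x, (2:ℝ) ^ (-k))) two_pos
        fun H hH H' hH' h h' => eq_of_mem_stopChildren_of_mem hH hH'
          (mem_idxCube_of_testFn_ne_zero (mul_ne_zero_iff.1 h).2)
          (mem_idxCube_of_testFn_ne_zero (mul_ne_zero_iff.1 h').2)
      simpa only [ENNReal.rpow_two, mul_pow, childTest] using this
    calc vertL2 n (childTest σ p' μ f 𝓖 G) x ^ p
        ≤ (∑' k : ℤ, ∑ H ∈ stopChildren 𝓖 G,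
            a H ^ 2 * testFn n p' μ H.1 H.2 (x, (2:ℝ) ^ (-k)) ^ 2) ^ (p / 2) := by
          rw [vertL2_rpow]
          exact ENNReal.rpow_le_rpow (ENNReal.tsum_le_tsum h1) (by positivity)
      _ = (∑ H ∈ stopChildren 𝓖 G,
            (a H * vertL2 n (testFn n p' μ H.1 H.2) x) ^ 2) ^ (p / 2) := by
          rw [Summable.tsum_finsetSum fun _ _ => ENNReal.summable]
          simp only [ENNReal.tsum_mul_left, mul_pow, vertL2_sq]
      _ ≤ ∑ H ∈ stopChildren 𝓖 G,
            ((a H * vertL2 n (testFn n p' μ H.1 H.2) x) ^ 2) ^ (p / 2) := by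
          refine rpow_sum_le_of_eq_of_ne_zero (by positivity) fun H hH H' hH' h h' => ?_
          rw [Ne, pow_eq_zero_iff two_ne_zero] at h h'
          exact eq_of_mem_stopChildren_of_mem hH hH'
            (mem_idxCube_of_vertL2_testFn_ne_zero hp.symm.lt (mul_ne_zero_iff.1 h).2)
            (mem_idxCube_of_vertL2_testFn_ne_zero hp.symm.lt (mul_ne_zero_iff.1 h').2)
      _ = _ := by
          refine Finset.sum_congr rfl fun H _ => ?_
          rw [← ENNReal.rpow_two, ← ENNReal.rpow_mul, mul_div_cancel₀ _ (two_ne_zero' ℝ),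
            ENNReal.mul_rpow_of_nonneg _ _ hp0.le]
  refine (lintegral_mono key).trans ?_
  rw [lintegral_finsetSum _ fun H _ => (hM H).const_mul _]
  refine Finset.sum_le_sum fun H _ => ?_
  rw [lintegral_const_mul _ (hM H), ← mixedNorm_rpow σ hp0]
  refine mul_le_mul' le_rfl ?_
  rw [← ENNReal.le_rpow_inv_iff hp0, ← one_div]
  exact mixedNorm_testFn_le σ hp μ H

theorem sum_lintegral_vertL2_stopRest_le (σ : Measure (Fin n → ℝ)) {p : ℝ} (hp : 2 ≤ p)
    {f : (Fin n → ℝ) × ℝ → ℝ≥0∞} (hf : Measurable f) (𝓖 : Finset (DyCube n)) :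
    ∑ G ∈ 𝓖, ∫⁻ x, vertL2 n ((stopRest cbox 𝓖 G).indicator f) x ^ p ∂σ
      ≤ ∫⁻ x, vertL2 n f x ^ p ∂σ := by
  have hm : ∀ G : DyCube n, Measurable fun x =>
      vertL2 n ((stopRest cbox 𝓖 G).indicator f) x ^ p := fun G =>
    (measurable_vertL2 (hf.indicator
      (measurableSet_stopRest measurableSet_cbox 𝓖 G))).pow_const _
  rw [← lintegral_finsetSum _ fun G _ => hm G]
  refine lintegral_mono fun x => ?_
  simp only [vertL2_rpow]
  refine (sum_rpow_le_rpow_sum (by linarith) 𝓖 _).trans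
    (ENNReal.rpow_le_rpow ?_ (by linarith))
  rw [← Summable.tsum_finsetSum fun _ _ => ENNReal.summable]
  refine ENNReal.tsum_le_tsum fun k => ?_
  refine sum_le_of_eq_of_ne_zero (fun G _ => ?_) fun F hF G hG h1 h2 => ?_
  · exact pow_le_pow_left₀ zero_le (indicator_le_self _ _ _) 2
  · rw [Ne, pow_eq_zero_iff two_ne_zero] at h1 h2
    exact eq_of_mem_stopRest DyCube.isForest (fun _ _ h => cbox_mono h)
      (fun _ _ _ => DyCube.le_or_le_of_mem_cbox) hF hG (mem_of_indicator_ne_zero h1)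
      (mem_of_indicator_ne_zero h2)

theorem sum_isStopTop_le_of_dual_testing (σ ω : Measure (Fin n → ℝ)) [IsLocallyFiniteMeasure ω]
    {p p' : ℝ} (hp : p.HolderConjugate p') {μ f : (Fin n → ℝ) × ℝ → ℝ≥0∞}
    (hμ : Measurable μ) (hf : Measurable f) (hN : ∀ Q, boxMass σ p' μ Q ≠ ∞)
    (g : (Fin n → ℝ) → ℝ≥0∞) (lam : CubeIdx n → ℝ≥0) {t : ℝ≥0∞}
    (ht : ∀ (Q : CubeIdx n) (f : (Fin n → ℝ) × ℝ → ℝ≥0∞), Measurable f →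
      lambdaLoc n σ ω μ lam Q f ((idxCube n Q).indicator 1)
        ≤ t * mixedNorm n σ p f * (ω (idxCube n Q)) ^ (1 / p'))
    {𝓖 T : Finset (DyCube n)} {G : DyCube n}
    (hT : ∀ Q ∈ T, IsStopTop 𝓖 G Q ∧ cubeAvg n ω g Q.1 Q.2 ≤ 2 * cubeAvg n ω g G.1 G.2) :
    ∑ Q ∈ T, (lam Q : ℝ≥0∞) * boxInt n σ μ f Q.1 Q.2 * ∫⁻ x in idxCube n Q, g x ∂ω
      ≤ 2 * t * (cubeAvg n ω g G.1 G.2 * ω (idxCube n G) ^ (1 / p')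
        * ((∫⁻ x, vertL2 n ((stopRest cbox 𝓖 G).indicator f) x ^ p ∂σ) ^ (1 / p)
          + (∑ H ∈ stopChildren 𝓖 G, boxAvg σ p' μ f H ^ p * boxMass σ p' μ H) ^ (1 / p))) := by
  set b := cubeAvg n ω g G.1 G.2
  set E := stopRest cbox 𝓖 G
  have hE : Measurable (E.indicator f) :=
    hf.indicator (measurableSet_stopRest measurableSet_cbox 𝓖 G)
  have hle : ∀ Q ∈ T, Q ≤ G := fun Q hQ => (hT Q hQ).1.2.1
  have h0 : 0 ≤ 1 / p := by simpa using hp.nonneg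
  have htest : ∀ h : (Fin n → ℝ) × ℝ → ℝ≥0∞, Measurable h → ∀ y,
      ∫⁻ x, vertL2 n h x ^ p ∂σ ≤ y →
      ∑ Q ∈ T, (lam Q : ℝ≥0∞) * boxInt n σ μ h Q.1 Q.2
          * ∫⁻ x in idxCube n Q, (idxCube n G).indicator 1 x ∂ω
        ≤ t * y ^ (1 / p) * ω (idxCube n G) ^ (1 / p') := fun h hh y hy => by
    refine ((sum_le_lambdaLoc σ ω μ lam hle h _).trans (ht G h hh)).trans ?_
    exact mul_le_mul' (mul_le_mul' le_rfl (ENNReal.rpow_le_rpow hy h0)) le_rfl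
  have hv : ∀ Q ∈ T, ∫⁻ x in idxCube n Q, g x ∂ω
      ≤ 2 * b * ∫⁻ x in idxCube n Q, (idxCube n G).indicator 1 x ∂ω := fun Q hQ => by
    rw [← cubeAvg_mul_measure, lintegral_indicator_one (measurableSet_idxCube G),
      Measure.restrict_apply (measurableSet_idxCube G), inter_eq_right.2 (hle Q hQ).2]
    exact mul_le_mul' (hT Q hQ).2 le_rfl
  calc ∑ Q ∈ T, (lam Q : ℝ≥0∞) * boxInt n σ μ f Q.1 Q.2 * ∫⁻ x in idxCube n Q, g x ∂ω
      ≤ ∑ Q ∈ T, (lam Q : ℝ≥0∞) * (boxInt n σ μ (E.indicator f) Q.1 Q.2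
          + boxInt n σ μ (childTest σ p' μ f 𝓖 G) Q.1 Q.2)
          * (2 * b * ∫⁻ x in idxCube n Q, (idxCube n G).indicator 1 x ∂ω) :=
        Finset.sum_le_sum fun Q hQ => mul_le_mul' (mul_le_mul' le_rfl
          (boxInt_le_stopRest_add σ hp hμ hf hN (hT Q hQ).1)) (hv Q hQ)
    _ = 2 * b * (∑ Q ∈ T, (lam Q : ℝ≥0∞) * boxInt n σ μ (E.indicator f) Q.1 Q.2
            * ∫⁻ x in idxCube n Q, (idxCube n G).indicator 1 x ∂ω
          + ∑ Q ∈ T, (lam Q : ℝ≥0∞) * boxInt n σ μ (childTest σ p' μ f 𝓖 G) Q.1 Q.2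
            * ∫⁻ x in idxCube n Q, (idxCube n G).indicator 1 x ∂ω) := by
        rw [← Finset.sum_add_distrib, Finset.mul_sum]
        refine Finset.sum_congr rfl fun Q _ => ?_
        ring
    _ ≤ 2 * b * (t * (∫⁻ x, vertL2 n (E.indicator f) x ^ p ∂σ) ^ (1 / p)
            * ω (idxCube n G) ^ (1 / p')
          + t * (∑ H ∈ stopChildren 𝓖 G, boxAvg σ p' μ f H ^ p * boxMass σ p' μ H) ^ (1 / p)
            * ω (idxCube n G) ^ (1 / p')) :=
        mul_le_mul' le_rfl (add_le_add (htest _ hE _ le_rfl)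
          (htest _ (measurable_childTest σ p' hμ f 𝓖 G) _
            (lintegral_vertL2_childTest_le σ hp hμ f 𝓖 G)))
    _ = _ := by ring

/-- The estimate for the cubes where the average of `g` dominates. -/
theorem sum_le_of_dual_testing (σ ω : Measure (Fin n → ℝ)) [IsLocallyFiniteMeasure ω]
    {p p' : ℝ} (hp : p.HolderConjugate p') (hp2 : 2 ≤ p) {μ f : (Fin n → ℝ) × ℝ → ℝ≥0∞}
    {g : (Fin n → ℝ) → ℝ≥0∞} (hμ : Measurable μ) (hf : Measurable f) (hg : Measurable g)
    (hfn : mixedNorm n σ p f ≤ 1) (hgn : _root_.lpNorm n ω p' g ≤ 1)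
    (hN : ∀ Q, boxMass σ p' μ Q ≠ ∞) (lam : CubeIdx n → ℝ≥0) {t : ℝ≥0∞}
    (ht : ∀ (Q : CubeIdx n) (f : (Fin n → ℝ) × ℝ → ℝ≥0∞), Measurable f →
      lambdaLoc n σ ω μ lam Q f ((idxCube n Q).indicator 1)
        ≤ t * mixedNorm n σ p f * (ω (idxCube n Q)) ^ (1 / p'))
    {𝓐 : Finset (DyCube n)}
    (h𝓐 : ∀ Q ∈ 𝓐, boxAvg σ p' μ f Q ^ p * boxMass σ p' μ Q
      ≤ cubeAvg n ω g Q.1 Q.2 ^ p' * ω (idxCube n Q)) :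
    ∑ Q ∈ 𝓐, (lam Q : ℝ≥0∞) * boxInt n σ μ f Q.1 Q.2 * ∫⁻ x in idxCube n Q, g x ∂ω
      ≤ 2 * t * (geomConst (p' - 1) + geomConst (p' - 1) ^ p') := by
  obtain ⟨𝓖, hsub, htop, hS⟩ := exists_g_stopping ω hp hg
    (ne_top_of_le_ne_top ENNReal.one_ne_top hgn) 𝓐
  set S := ∑ G ∈ 𝓖, cubeAvg n ω g G.1 G.2 ^ p' * ω (idxCube n G)
  have hS' : S ≤ geomConst (p' - 1) ^ p' :=
    hS.trans (ENNReal.rpow_le_rpow (mul_le_of_le_one_right zero_le hgn) hp.symm.nonneg)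
  have hx : ∑ G ∈ 𝓖, ∫⁻ x, vertL2 n ((stopRest cbox 𝓖 G).indicator f) x ^ p ∂σ ≤ 1 := by
    refine (sum_lintegral_vertL2_stopRest_le σ hp2 hf 𝓖).trans ?_
    rw [← mixedNorm_rpow σ hp.pos]
    exact ENNReal.rpow_le_one hfn hp.nonneg
  have hy : ∑ G ∈ 𝓖, ∑ H ∈ stopChildren 𝓖 G, boxAvg σ p' μ f H ^ p * boxMass σ p' μ H ≤ S :=
    (IsForest.sum_stopChildren_le fun H : DyCube n =>
      boxAvg σ p' μ f H ^ p * boxMass σ p' μ H).trans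
      (Finset.sum_le_sum fun G hG => h𝓐 G (hsub hG))
  refine (sum_le_sum_isStopTop (fun Q hQ => (htop Q hQ).imp fun _ h => h.1) _).trans ?_
  calc _ ≤ ∑ G ∈ 𝓖, 2 * t * (cubeAvg n ω g G.1 G.2 * ω (idxCube n G) ^ (1 / p')
        * ((∫⁻ x, vertL2 n ((stopRest cbox 𝓖 G).indicator f) x ^ p ∂σ) ^ (1 / p)
          + (∑ H ∈ stopChildren 𝓖 G, boxAvg σ p' μ f H ^ p * boxMass σ p' μ H)
            ^ (1 / p))) := by
        refine Finset.sum_le_sum fun G _ =>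
          sum_isStopTop_le_of_dual_testing σ ω hp hμ hf hN g lam ht fun Q hQ => ?_
        obtain ⟨hQ, hQG⟩ := Finset.mem_filter.1 hQ
        obtain ⟨H, hH, hok⟩ := htop Q hQ
        exact ⟨hQG, hQG.unique hH ▸ hok⟩
    _ ≤ 2 * t * (S ^ (1 / p') + S) := by
        rw [← Finset.mul_sum]
        exact mul_le_mul' le_rfl (sum_stopping_le hp.symm 𝓖
          (fun G : DyCube n => cubeAvg n ω g G.1 G.2) (fun G => ω (idxCube n G)) _ _ hx hy)
    _ ≤ _ := by
        refine mul_le_mul' le_rfl (add_le_add ?_ hS')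
        rw [one_div, ENNReal.rpow_inv_le_iff hp.symm.pos]
        exact hS'

end OneSidedG

section Main

variable {n : ℕ}

/-- The constant in the upper bound of the norm by the testing constants. -/
def testingConst (p : ℝ) : ℝ≥0∞ :=
  decayConst p ^ 2 * (2 * geomConst (p - 1) + (2 * geomConst (p - 1)) ^ p)
    + 2 * (geomConst (p / (p - 1) - 1) + geomConst (p / (p - 1) - 1) ^ (p / (p - 1))) + 1

theorem one_le_testingConst (p : ℝ) : 1 ≤ testingConst p := le_add_self

theorem testingConst_ne_top {p : ℝ} (hp : p.HolderConjugate (p / (p - 1))) :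
    testingConst p ≠ ∞ := by
  have h1 := geomConst_ne_top hp.sub_one_pos
  have h2 := geomConst_ne_top hp.symm.sub_one_pos
  have h3 : 2 * geomConst (p - 1) ≠ ∞ := ENNReal.mul_ne_top (by norm_num) h1
  exact ENNReal.add_ne_top.2 ⟨ENNReal.add_ne_top.2
    ⟨ENNReal.mul_ne_top (ENNReal.pow_ne_top (decayConst_ne_top hp.pos))
      (ENNReal.add_ne_top.2 ⟨h3, ENNReal.rpow_ne_top_of_nonneg hp.nonneg h3⟩),
    ENNReal.mul_ne_top (by norm_num)
      (ENNReal.add_ne_top.2 ⟨h2, ENNReal.rpow_ne_top_of_nonneg hp.symm.nonneg h2⟩)⟩,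
    ENNReal.one_ne_top⟩

theorem mixedNorm_const_mul (σ : Measure (Fin n → ℝ)) {q : ℝ} (hq : 0 < q) (c : ℝ≥0∞)
    {f : (Fin n → ℝ) × ℝ → ℝ≥0∞} (hf : Measurable f) :
    mixedNorm n σ q (fun z => c * f z) = c * mixedNorm n σ q f := by
  unfold mixedNorm
  simp only [vertL2_weight_mul (fun _ => c), ENNReal.mul_rpow_of_nonneg _ _ hq.le]
  rw [lintegral_const_mul _ ((measurable_vertL2 hf).pow_const _),
    ENNReal.mul_rpow_of_nonneg _ _ (by positivity), ← ENNReal.rpow_mul,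
    mul_one_div_cancel hq.ne', ENNReal.rpow_one]

theorem lpNorm_const_mul (ω : Measure (Fin n → ℝ)) {q : ℝ} (hq : 0 < q) (c : ℝ≥0∞)
    {g : (Fin n → ℝ) → ℝ≥0∞} (hg : Measurable g) :
    _root_.lpNorm n ω q (fun x => c * g x) = c * _root_.lpNorm n ω q g := by
  unfold _root_.lpNorm
  simp only [ENNReal.mul_rpow_of_nonneg _ _ hq.le]
  rw [lintegral_const_mul _ (hg.pow_const _), ENNReal.mul_rpow_of_nonneg _ _ (by positivity),
    ← ENNReal.rpow_mul, mul_one_div_cancel hq.ne', ENNReal.rpow_one]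

theorem lambdaForm_const_mul (σ ω : Measure (Fin n → ℝ)) {μ f : (Fin n → ℝ) × ℝ → ℝ≥0∞}
    (hμ : Measurable μ) (lam : CubeIdx n → ℝ≥0) (hf : Measurable f)
    {g : (Fin n → ℝ) → ℝ≥0∞} (hg : Measurable g) (c d : ℝ≥0∞) :
    lambdaForm n σ ω μ lam (fun z => c * f z) (fun x => d * g x)
      = c * d * lambdaForm n σ ω μ lam f g := by
  unfold lambdaForm
  rw [← ENNReal.tsum_mul_left]
  refine tsum_congr fun Q => ?_
  rw [boxInt_const_mul σ hμ hf c Q, lintegral_const_mul _ hg]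
  ring

theorem lambdaLoc_le_lambdaForm (σ ω : Measure (Fin n → ℝ)) (μ : (Fin n → ℝ) × ℝ → ℝ≥0∞)
    (lam : CubeIdx n → ℝ≥0) (Q : CubeIdx n) (f : (Fin n → ℝ) × ℝ → ℝ≥0∞)
    (g : (Fin n → ℝ) → ℝ≥0∞) :
    lambdaLoc n σ ω μ lam Q f g ≤ lambdaForm n σ ω μ lam f g := by
  refine ENNReal.tsum_le_tsum fun R => ?_
  split_ifs
  · exact le_rfl
  · exact zero_le

theorem lpNorm_indicator_one (ω : Measure (Fin n → ℝ)) {q : ℝ} (hq : 0 < q) (Q : CubeIdx n) :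
    _root_.lpNorm n ω q ((idxCube n Q).indicator 1) = ω (idxCube n Q) ^ (1 / q) := by
  rw [_root_.lpNorm, ← lintegral_indicator_one (measurableSet_idxCube Q)]
  congr 2 with x
  by_cases hx : x ∈ idxCube n Q <;> simp [hx, hq]

theorem lambdaForm_le_of_norm_le_one (σ ω : Measure (Fin n → ℝ)) [IsLocallyFiniteMeasure ω]
    {p : ℝ} (hp : p.HolderConjugate (p / (p - 1))) (hp2 : 2 ≤ p) (hp2' : p / (p - 1) ≤ 2)
    {μ f : (Fin n → ℝ) × ℝ → ℝ≥0∞}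
    {g : (Fin n → ℝ) → ℝ≥0∞} (hμ : Measurable μ) (hf : Measurable f) (hg : Measurable g)
    (hfn : mixedNorm n σ p f ≤ 1) (hgn : _root_.lpNorm n ω (p / (p - 1)) g ≤ 1)
    (hN : ∀ Q, boxMass σ (p / (p - 1)) μ Q ≠ ∞) (lam : CubeIdx n → ℝ≥0) {t s : ℝ≥0∞}
    (ht : ∀ (Q : CubeIdx n) (g : (Fin n → ℝ) → ℝ≥0∞), Measurable g →
      lambdaLoc n σ ω μ lam Q (testFn n (p / (p - 1)) μ Q.1 Q.2) g
        ≤ t * mixedNorm n σ p (testFn n (p / (p - 1)) μ Q.1 Q.2)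
          * _root_.lpNorm n ω (p / (p - 1)) g)
    (hs : ∀ (Q : CubeIdx n) (f : (Fin n → ℝ) × ℝ → ℝ≥0∞), Measurable f →
      lambdaLoc n σ ω μ lam Q f ((idxCube n Q).indicator 1)
        ≤ s * mixedNorm n σ p f * (ω (idxCube n Q)) ^ (1 / (p / (p - 1)))) :
    lambdaForm n σ ω μ lam f g ≤ testingConst p * (t + s) := by
  rw [lambdaForm, ENNReal.tsum_eq_iSup_sum]
  refine iSup_le fun 𝓐 => ?_
  rw [← Finset.sum_filter_add_sum_filter_not 𝓐 fun Q => cubeAvg n ω g Q.1 Q.2 ^ (p / (p - 1))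
    * ω (idxCube n Q) ≤ boxAvg σ (p / (p - 1)) μ f Q ^ p * boxMass σ (p / (p - 1)) μ Q]
  rw [mul_add]
  refine add_le_add ?_ ?_
  · refine (sum_le_of_testing σ ω hp hp2' hμ hf hg hfn hgn hN lam ht fun Q hQ =>
      (Finset.mem_filter.1 hQ).2).trans ?_
    rw [mul_right_comm]
    exact mul_le_mul' (le_self_add.trans le_self_add) le_rfl
  · refine (sum_le_of_dual_testing σ ω hp hp2 hμ hf hg hfn hgn hN lam hs fun Q hQ =>
      (not_le.1 (Finset.mem_filter.1 hQ).2).le).trans ?_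
    rw [mul_right_comm]
    exact mul_le_mul' (le_add_self.trans le_self_add) le_rfl

theorem lambdaForm_le_of_testing (σ ω : Measure (Fin n → ℝ)) [IsLocallyFiniteMeasure ω]
    {p : ℝ} (hp : p.HolderConjugate (p / (p - 1))) (hp2 : 2 ≤ p) (hp2' : p / (p - 1) ≤ 2)
    {μ f : (Fin n → ℝ) × ℝ → ℝ≥0∞}
    {g : (Fin n → ℝ) → ℝ≥0∞} (hμ : Measurable μ) (hf : Measurable f) (hg : Measurable g)
    (hN : ∀ Q, boxMass σ (p / (p - 1)) μ Q ≠ ∞) (lam : CubeIdx n → ℝ≥0) {t s : ℝ≥0∞}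
    (hts : t + s ≠ 0)
    (ht : ∀ (Q : CubeIdx n) (g : (Fin n → ℝ) → ℝ≥0∞), Measurable g →
      lambdaLoc n σ ω μ lam Q (testFn n (p / (p - 1)) μ Q.1 Q.2) g
        ≤ t * mixedNorm n σ p (testFn n (p / (p - 1)) μ Q.1 Q.2)
          * _root_.lpNorm n ω (p / (p - 1)) g)
    (hs : ∀ (Q : CubeIdx n) (f : (Fin n → ℝ) × ℝ → ℝ≥0∞), Measurable f →
      lambdaLoc n σ ω μ lam Q f ((idxCube n Q).indicator 1)
        ≤ s * mixedNorm n σ p f * (ω (idxCube n Q)) ^ (1 / (p / (p - 1)))) :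
    lambdaForm n σ ω μ lam f g
      ≤ testingConst p * (t + s) * mixedNorm n σ p f * _root_.lpNorm n ω (p / (p - 1)) g := by
  set p' := p / (p - 1)
  have hC : testingConst p * (t + s) ≠ 0 :=
    mul_ne_zero (zero_lt_one.trans_le (one_le_testingConst p)).ne' hts
  by_cases hf0 : mixedNorm n σ p f = 0
  · refine le_trans (le_of_eq (ENNReal.tsum_eq_zero.2 fun Q => ?_)) zero_le
    have := boxInt_le σ hp hμ hf Q
    rw [hf0, zero_mul] at this
    rw [le_antisymm this zero_le, mul_zero, zero_mul]
  by_cases hg0 : _root_.lpNorm n ω p' g = 0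
  · refine le_trans (le_of_eq (ENNReal.tsum_eq_zero.2 fun Q => ?_)) zero_le
    have := setLIntegral_idxCube_le ω hp hg Q
    rw [hg0, zero_mul] at this
    rw [le_antisymm this zero_le, mul_zero]
  by_cases hft : mixedNorm n σ p f = ∞
  · rw [hft, ENNReal.mul_top hC, ENNReal.top_mul hg0]
    exact le_top
  by_cases hgt : _root_.lpNorm n ω p' g = ∞
  · rw [hgt, ENNReal.mul_top (mul_ne_zero hC hf0)]
    exact le_top
  have key := lambdaForm_le_of_norm_le_one σ ω hp hp2 hp2' hμ
    (hf.const_mul (mixedNorm n σ p f)⁻¹) (hg.const_mul (_root_.lpNorm n ω p' g)⁻¹)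
    (by rw [mixedNorm_const_mul σ hp.pos _ hf, ENNReal.inv_mul_cancel hf0 hft])
    (by rw [lpNorm_const_mul ω hp.symm.pos _ hg, ENNReal.inv_mul_cancel hg0 hgt])
    hN lam ht hs
  rw [lambdaForm_const_mul σ ω hμ lam hf hg] at key
  generalize mixedNorm n σ p f = X at *
  generalize _root_.lpNorm n ω p' g = Y at *
  calc lambdaForm n σ ω μ lam f g
      = (X * X⁻¹) * (Y * Y⁻¹) * lambdaForm n σ ω μ lam f g := by
        rw [ENNReal.mul_inv_cancel hf0 hft, ENNReal.mul_inv_cancel hg0 hgt, one_mul, one_mul]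
    _ = X * Y * (X⁻¹ * Y⁻¹ * lambdaForm n σ ω μ lam f g) := by ring
    _ ≤ X * Y * (testingConst p * (t + s)) := mul_le_mul' le_rfl key
    _ = _ := by ring

theorem testConstT_le_of_bound (σ ω : Measure (Fin n → ℝ)) {μ : (Fin n → ℝ) × ℝ → ℝ≥0∞}
    (hμ : Measurable μ) (lam : CubeIdx n → ℝ≥0) {p : ℝ} {C : ℝ≥0∞}
    (h : ∀ (f : (Fin n → ℝ) × ℝ → ℝ≥0∞) (g : (Fin n → ℝ) → ℝ≥0∞),
      Measurable f → Measurable g → lambdaForm n σ ω μ lam f g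
        ≤ C * mixedNorm n σ p f * _root_.lpNorm n ω (p / (p - 1)) g) :
    testConstT n σ ω μ lam p ≤ C :=
  sInf_le fun Q g hg => (lambdaLoc_le_lambdaForm σ ω μ lam Q _ g).trans
    (h _ g (measurable_testFn _ hμ Q) hg)

theorem testConstTStar_le_of_bound (σ ω : Measure (Fin n → ℝ))
    {μ : (Fin n → ℝ) × ℝ → ℝ≥0∞} (lam : CubeIdx n → ℝ≥0) {p : ℝ} (hp : 0 < p / (p - 1))
    {C : ℝ≥0∞}
    (h : ∀ (f : (Fin n → ℝ) × ℝ → ℝ≥0∞) (g : (Fin n → ℝ) → ℝ≥0∞),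
      Measurable f → Measurable g → lambdaForm n σ ω μ lam f g
        ≤ C * mixedNorm n σ p f * _root_.lpNorm n ω (p / (p - 1)) g) :
    testConstTStar n σ ω μ lam p ≤ C :=
  sInf_le fun Q f hf => by
    rw [← lpNorm_indicator_one ω hp Q]
    exact (lambdaLoc_le_lambdaForm σ ω μ lam Q f _).trans
      (h f _ hf (measurable_one.indicator (measurableSet_idxCube Q)))

theorem lambdaForm_le_of_testConst_add (σ ω : Measure (Fin n → ℝ)) [IsLocallyFiniteMeasure ω]
    {p : ℝ} (hp : p.HolderConjugate (p / (p - 1))) (hp2 : 2 ≤ p) (hp2' : p / (p - 1) ≤ 2)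
    {μ f : (Fin n → ℝ) × ℝ → ℝ≥0∞}
    {g : (Fin n → ℝ) → ℝ≥0∞} (hμ : Measurable μ) (hf : Measurable f) (hg : Measurable g)
    (hN : ∀ Q, boxMass σ (p / (p - 1)) μ Q ≠ ∞) (lam : CubeIdx n → ℝ≥0)
    (hfin : testConstT n σ ω μ lam p + testConstTStar n σ ω μ lam p < ∞)
    {δ : ℝ≥0∞} (hδ : δ ≠ 0) :
    lambdaForm n σ ω μ lam f g
      ≤ testingConst p * ((testConstT n σ ω μ lam p + δ) + (testConstTStar n σ ω μ lam p + δ))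
        * mixedNorm n σ p f * _root_.lpNorm n ω (p / (p - 1)) g := by
  obtain ⟨hT, hS⟩ := ENNReal.add_lt_top.1 hfin
  obtain ⟨t, ht, htlt⟩ := sInf_lt_iff.1 (ENNReal.lt_add_right hT.ne hδ)
  obtain ⟨s, hs, hslt⟩ := sInf_lt_iff.1 (ENNReal.lt_add_right hS.ne hδ)
  refine lambdaForm_le_of_testing σ ω hp hp2 hp2' hμ hf hg hN lam (by simp [hδ])
    (fun Q g hg => (ht Q g hg).trans ?_) fun Q f hf => (hs Q f hf).trans ?_
  · exact mul_le_mul' (mul_le_mul' htlt.le le_rfl) le_rfl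
  · exact mul_le_mul' (mul_le_mul' hslt.le le_rfl) le_rfl

end Main

/-- Theorem 1.1: testing characterization of the boundedness of the bilinear form `Λ`
for `p ∈ [2,∞)`, with `‖Λ‖ ≃ 𝒯 + 𝒯*` (constants depending only on `p`). -/
theorem statement0 :
    ∀ p : ℝ, 2 ≤ p → ∃ c C : ℝ≥0∞, 0 < c ∧ C < ∞ ∧
    ∀ (n : ℕ), 0 < n →
    ∀ (σ ω : Measure (Fin n → ℝ)),
      IsLocallyFiniteMeasure σ → IsLocallyFiniteMeasure ω →
    ∀ (μ : (Fin n → ℝ) × ℝ → ℝ≥0∞), Measurable μ →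
    (∀ Q : CubeIdx n, mixedNorm n σ (p/(p-1)) (boxFn n μ Q.1 Q.2) < ∞) →
    ∀ lam : CubeIdx n → ℝ≥0,
      ((∃ C₀ : ℝ≥0∞, C₀ < ∞ ∧
          ∀ (f : (Fin n → ℝ) × ℝ → ℝ≥0∞) (g : (Fin n → ℝ) → ℝ≥0∞),
            Measurable f → Measurable g →
            lambdaForm n σ ω μ lam f g
              ≤ C₀ * mixedNorm n σ p f * lpNorm n ω (p/(p-1)) g)
        ↔ testConstT n σ ω μ lam p + testConstTStar n σ ω μ lam p < ∞)
      ∧ (testConstT n σ ω μ lam p + testConstTStar n σ ω μ lam p < ∞ →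
          c * (testConstT n σ ω μ lam p + testConstTStar n σ ω μ lam p)
              ≤ lambdaNorm n σ ω μ lam p
            ∧ lambdaNorm n σ ω μ lam p
              ≤ C * (testConstT n σ ω μ lam p + testConstTStar n σ ω μ lam p)) := by
  intro p hp2
  have hp : p.HolderConjugate (p / (p - 1)) := Real.HolderConjugate.conjExponent (by linarith)
  have hp2' : p / (p - 1) ≤ 2 := by
    rw [div_le_iff₀ (by linarith)]
    linarith
  have hCt := testingConst_ne_top hp
  have hC0 : testingConst p ≠ 0 := (zero_lt_one.trans_le (one_le_testingConst p)).ne'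
  refine ⟨2⁻¹, testingConst p, by simp, hCt.lt_top, ?_⟩
  intro n _ σ ω _ _ μ hμ hbox lam
  have hN : ∀ Q, boxMass σ (p / (p - 1)) μ Q ≠ ∞ := fun Q => by
    rw [boxMass, ← mixedNorm_rpow σ hp.symm.pos]
    exact ENNReal.rpow_ne_top_of_nonneg hp.symm.nonneg (hbox Q).ne
  refine ⟨⟨?_, fun hfin => ?_⟩, fun hfin => ⟨?_, ?_⟩⟩
  · rintro ⟨C₀, hC₀, h⟩
    exact ENNReal.add_lt_top.2 ⟨(testConstT_le_of_bound σ ω hμ lam h).trans_lt hC₀,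
      (testConstTStar_le_of_bound σ ω lam hp.symm.pos h).trans_lt hC₀⟩
  · obtain ⟨hT, hS⟩ := ENNReal.add_lt_top.1 hfin
    refine ⟨_, ?_, fun f g hf hg =>
      lambdaForm_le_of_testConst_add σ ω hp hp2 hp2' hμ hf hg hN lam hfin one_ne_zero⟩
    exact ENNReal.mul_lt_top hCt.lt_top
      (ENNReal.add_lt_top.2 ⟨ENNReal.add_lt_top.2 ⟨hT, ENNReal.one_lt_top⟩,
        ENNReal.add_lt_top.2 ⟨hS, ENNReal.one_lt_top⟩⟩)
  · refine le_sInf fun C h => ?_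
    calc 2⁻¹ * (testConstT n σ ω μ lam p + testConstTStar n σ ω μ lam p)
        ≤ 2⁻¹ * (C + C) := mul_le_mul' le_rfl
          (add_le_add (testConstT_le_of_bound σ ω hμ lam h)
            (testConstTStar_le_of_bound σ ω lam hp.symm.pos h))
      _ = C := by
        rw [← two_mul, ← mul_assoc, ENNReal.inv_mul_cancel (by norm_num) (by norm_num), one_mul]
  · refine ENNReal.le_of_forall_pos_le_add fun ε hε _ => ?_
    have h2C0 : 2 * testingConst p ≠ 0 := mul_ne_zero two_ne_zero hC0
    have h2Ct : 2 * testingConst p ≠ ∞ := ENNReal.mul_ne_top (by norm_num) hCt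
    have hδ : (ε : ℝ≥0∞) * (2 * testingConst p)⁻¹ ≠ 0 :=
      mul_ne_zero (by exact_mod_cast hε.ne') (ENNReal.inv_ne_zero.2 h2Ct)
    have e : 2 * testingConst p * ((ε : ℝ≥0∞) * (2 * testingConst p)⁻¹) = ε := by
      rw [mul_left_comm, ENNReal.mul_inv_cancel h2C0 h2Ct, mul_one]
    have hle : lambdaNorm n σ ω μ lam p ≤ testingConst p *
        ((testConstT n σ ω μ lam p + (ε : ℝ≥0∞) * (2 * testingConst p)⁻¹) +
          (testConstTStar n σ ω μ lam p + (ε : ℝ≥0∞) * (2 * testingConst p)⁻¹)) :=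
      sInf_le fun f g hf hg =>
        lambdaForm_le_of_testConst_add σ ω hp hp2 hp2' hμ hf hg hN lam hfin hδ
    generalize (ε : ℝ≥0∞) * (2 * testingConst p)⁻¹ = δ at e hle
    rw [← e]
    exact hle.trans (le_of_eq (by ring))

end
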